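/- arXiv:1601.03911 — 3 statements merged into one kernel-verified Lean document; each statement's English description precedes it below -/
import Mathlib

section
/- Let 1 < α ≤ 2, β₁ > 1/(α−1) and 1/α < β₂ < 1/(α−1). Then the doubly-indexed limit, as n → ∞ and m → ∞ (along the product filter), of ρ(n,m)/(n^{−β₁} m^{1−β₂α}) exists and equals (Σ_{i=0}^∞ w_{(i,∞)}^{α−1} (1+i)^{−β₁(α−1)}) · ∫₀^∞ u^{−β₂(α−1)} (1+u)^{−β₂} du. -/
open Filter MeasureTheory Real Set

/-- The kernel `V(x,y) = xy/(x^2+y^2)^{(2-α)/2}` with `V(0,0)=0`. -/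
noncomputable def V (α : ℝ) : ℝ → ℝ → ℝ := fun x y =>
  if x = 0 ∧ y = 0 then 0 else x * y / (x ^ 2 + y ^ 2) ^ ((2 - α) / 2)

lemma aux_bdd (w : ℕ → ℕ → ℝ)
    (hA1 : Tendsto (fun p : ℕ × ℕ => w p.1 p.2) (atTop ×ˢ atTop) (nhds 1))
    (winf : ℕ → ℝ) (hA2 : ∀ i, Tendsto (fun j => w i j) atTop (nhds (winf i)))
    (wco : ℕ → ℝ) (hA3 : ∀ j, Tendsto (fun i => w i j) atTop (nhds (wco j))) :
    ∃ M : ℝ, 0 < M ∧ ∀ i j, |w i j| ≤ M := by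
  have h1 : ∀ i, ∃ M, ∀ j, |w i j| ≤ M := fun i => by
    obtain ⟨M, hM⟩ := (hA2 i).abs.bddAbove_range
    exact ⟨M, fun j => hM ⟨j, rfl⟩⟩
  have h2 : ∀ j, ∃ M, ∀ i, |w i j| ≤ M := fun j => by
    obtain ⟨M, hM⟩ := (hA3 j).abs.bddAbove_range
    exact ⟨M, fun i => hM ⟨i, rfl⟩⟩
  choose R hR using h1
  choose S hS using h2
  have hR0 : ∀ i, 0 ≤ R i := fun i => (abs_nonneg _).trans (hR i 0)
  have hS0 : ∀ i, 0 ≤ S i := fun i => (abs_nonneg _).trans (hS i 0)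
  have h3 : ∀ᶠ p : ℕ × ℕ in atTop ×ˢ atTop, |w p.1 p.2| < 2 :=
    hA1.abs.eventually_lt_const (by norm_num)
  rw [prod_atTop_atTop_eq] at h3
  obtain ⟨⟨a, b⟩, h⟩ := eventually_atTop.1 h3
  have e1 : 0 ≤ ∑ i ∈ Finset.range a, R i := Finset.sum_nonneg fun i _ => hR0 i
  have e2 : 0 ≤ ∑ i ∈ Finset.range b, S i := Finset.sum_nonneg fun i _ => hS0 i
  refine ⟨2 + ∑ i ∈ Finset.range a, R i + ∑ j ∈ Finset.range b, S j, by linarith, fun i j => ?_⟩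
  by_cases hi : i < a
  · have := Finset.single_le_sum (fun i _ => hR0 i) (Finset.mem_range.2 hi)
    have := hR i j
    linarith
  by_cases hj : j < b
  · have := Finset.single_le_sum (fun i _ => hS0 i) (Finset.mem_range.2 hj)
    have := hS j i
    linarith
  have := h (i, j) ⟨not_lt.1 hi, not_lt.1 hj⟩
  simp only at this
  linarith

lemma aux_floor (f : ℕ → ℝ) (m : ℝ) (hm : 0 < m)
    (hf : IntegrableOn (fun v : ℝ => f ⌊m * v⌋₊) (Ioi 0)) :
    ∑' j, f j = m * ∫ v in Ioi (0:ℝ), f ⌊m * v⌋₊ := by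
  have h1 : IntegrableOn (fun u : ℝ => f ⌊u⌋₊) (Ioi 0) := by
    have := (integrableOn_Ioi_comp_mul_left_iff (fun u : ℝ => f ⌊u⌋₊) 0 hm).1 hf
    simpa using this
  have h2 := integral_comp_mul_left_Ioi (fun u : ℝ => f ⌊u⌋₊) 0 hm
  rw [h2, mul_zero, smul_eq_mul, mul_inv_cancel_left₀ hm.ne']
  have hU : (⋃ n : ℕ, Ico (n:ℝ) (n+1)) = Ici 0 := by
    ext x
    simp only [mem_iUnion, mem_Ico, mem_Ici]
    constructor
    · rintro ⟨n, h, -⟩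
      exact (Nat.cast_nonneg n).trans h
    · intro h
      exact ⟨⌊x⌋₊, Nat.floor_le h, Nat.lt_floor_add_one x⟩
  have hfl : ∀ (n : ℕ), ∀ u ∈ Ico (n:ℝ) (n+1), ⌊u⌋₊ = n := fun n u hu =>
    (Nat.floor_eq_iff ((Nat.cast_nonneg n).trans hu.1)).2 hu
  have h3 := hasSum_integral_iUnion (μ := volume) (f := fun u : ℝ => f ⌊u⌋₊)
    (s := fun n : ℕ => Ico (n:ℝ) (n+1)) (fun n => measurableSet_Ico) (by
      intro a b hab
      refine Set.disjoint_left.2 fun x hx hy => hab ?_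
      rw [← hfl a x hx, ← hfl b x hy]) (by
      rw [hU, integrableOn_Ici_iff_integrableOn_Ioi]; exact h1)
  rw [hU, integral_Ici_eq_integral_Ioi] at h3
  rw [← h3.tsum_eq]
  refine tsum_congr fun n => ?_
  rw [setIntegral_congr_fun (g := fun _ => f n) measurableSet_Ico
    (fun u hu => by simp only [hfl n u hu])]
  simp

lemma aux_int (a b : ℝ) (ha : a < 1) (hb : 0 ≤ b) (hab : 1 < a + b) :
    IntegrableOn (fun v : ℝ => v ^ (-a) * (1 + v) ^ (-b)) (Ioi 0) := by
  have hmeas : Measurable (fun v : ℝ => v ^ (-a) * (1 + v) ^ (-b)) := by fun_prop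
  rw [← Ioc_union_Ioi_eq_Ioi (zero_le_one (α := ℝ))]
  refine IntegrableOn.union ?_ ?_
  · have h : IntegrableOn (fun v : ℝ => v ^ (-a)) (Ioc 0 1) := by
      rw [← intervalIntegrable_iff_integrableOn_Ioc_of_le zero_le_one]
      exact intervalIntegral.intervalIntegrable_rpow' (by linarith)
    refine Integrable.mono' h hmeas.aestronglyMeasurable ?_
    refine (ae_restrict_iff' measurableSet_Ioc).2 (Eventually.of_forall fun v hv => ?_)
    have hv0 : 0 < v := hv.1
    rw [Real.norm_of_nonneg (by positivity)]
    exact mul_le_of_le_one_right (by positivity)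
      (rpow_le_one_of_one_le_of_nonpos (by linarith) (by linarith))
  · have h : IntegrableOn (fun v : ℝ => v ^ (-a + -b)) (Ioi 1) :=
      integrableOn_Ioi_rpow_of_lt (by linarith) one_pos
    refine Integrable.mono' h hmeas.aestronglyMeasurable ?_
    refine (ae_restrict_iff' measurableSet_Ioi).2 (Eventually.of_forall fun v hv => ?_)
    have hv0 : 0 < v := one_pos.trans hv
    rw [Real.norm_of_nonneg (by positivity), rpow_add hv0]
    exact mul_le_mul_of_nonneg_left
      (rpow_le_rpow_of_nonpos hv0 (by linarith) (by linarith)) (by positivity)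

lemma aux_V (α P Q X Y : ℝ) (hP : 0 < P) (hX : X ≠ 0) :
    P ^ α * Q * V α (X / P) (Y / (P * Q)) =
      if Q = 0 then 0 else |X| ^ (α - 2) * X * Y * (1 + (Y / Q / X) ^ 2) ^ (-((2 - α) / 2)) := by
  split_ifs with hQ
  · simp [hQ]
  have hx : X / P ≠ 0 := div_ne_zero hX hP.ne'
  rw [V, if_neg (fun h => hx h.1)]
  have e : (X / P) ^ 2 + (Y / (P * Q)) ^ 2 = (|X| / P) ^ 2 * (1 + (Y / Q / X) ^ 2) := by
    rw [div_pow |X|, sq_abs]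
    field_simp
  have hX' : 0 < |X| := abs_pos.2 hX
  have e2 : ((|X| / P) ^ 2) ^ ((2 - α) / 2) = (|X| / P) ^ (2 - α) := by
    rw [← rpow_natCast, ← rpow_mul (by positivity)]
    congr 1
    push_cast; ring
  rw [e, mul_rpow (by positivity) (by positivity), e2, div_rpow hX'.le hP.le, rpow_neg (by positivity),
    rpow_sub hP, rpow_sub hX', rpow_sub hX', rpow_two, rpow_two, sq_abs]
  have : 0 < P ^ α := by positivity
  have : 0 < |X| ^ α := by positivity
  have : 0 < (1 + (Y / Q / X) ^ 2) ^ ((2 - α) / 2) := by positivity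
  set T := (1 + (Y / Q / X) ^ 2) ^ ((2 - α) / 2)
  field_simp

lemma aux_V_le (α P Q X Y : ℝ) (hα2 : α ≤ 2) (hP : 0 < P) (hX : X ≠ 0) :
    |P ^ α * Q * V α (X / P) (Y / (P * Q))| ≤ |X| ^ (α - 1) * |Y| := by
  rw [aux_V α P Q X Y hP hX]
  split_ifs with hQ
  · simp; positivity
  have hX' : 0 < |X| := abs_pos.2 hX
  have h : (1 + (Y / Q / X) ^ 2) ^ (-((2 - α) / 2)) ≤ 1 :=
    rpow_le_one_of_one_le_of_nonpos (by nlinarith [sq_nonneg (Y / Q / X)]) (by linarith)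
  have h0 : 0 ≤ (1 + (Y / Q / X) ^ 2) ^ (-((2 - α) / 2)) := by positivity
  have e : |X| ^ (α - 1) = |X| ^ (α - 2) * |X| := by
    rw [← rpow_add_one hX'.ne']; congr 1; ring
  rw [abs_mul, abs_mul, abs_mul, abs_of_nonneg h0, e, abs_of_nonneg (by positivity : 0 ≤ |X| ^ (α - 2))]
  exact mul_le_of_le_one_right (by positivity) h

theorem stmt2 (α β₁ β₂ : ℝ)
    (hα : 1 < α) (hα2 : α ≤ 2)
    (hβ₁ : 1 / (α - 1) < β₁) (hβ₂l : 1 / α < β₂) (hβ₂u : β₂ < 1 / (α - 1))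
    (w : ℕ → ℕ → ℝ) (hw : ∀ i j, w i j ≠ 0)
    (hA1 : Tendsto (fun p : ℕ × ℕ => w p.1 p.2) (atTop ×ˢ atTop) (nhds 1))
    (winf : ℕ → ℝ)
    (hA2 : ∀ i, Tendsto (fun j => w i j) atTop (nhds (winf i)) ∧ 0 < winf i)
    (wco : ℕ → ℝ)
    (hA3 : ∀ j, Tendsto (fun i => w i j) atTop (nhds (wco j)) ∧ 0 < wco j)
    (c : ℕ → ℕ → ℝ)
    (hc : ∀ i j, c i j = w i j * (1 + (i : ℝ)) ^ (-β₁) * (1 + (j : ℝ)) ^ (-β₂))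
    (ρ : ℕ → ℕ → ℝ)
    (hsum : ∀ n m : ℕ, 1 ≤ n → 1 ≤ m →
      Summable (fun q : ℕ × ℕ => V α (c q.1 q.2) (c (q.1 + n) (q.2 + m))))
    (hρ : ∀ n m : ℕ, 1 ≤ n → 1 ≤ m →
      ρ n m = ∑' i : ℕ, ∑' j : ℕ, V α (c i j) (c (i + n) (j + m)))
    :
    Tendsto (fun p : ℕ × ℕ => ρ p.1 p.2 / ((p.1 : ℝ) ^ (-β₁) * (p.2 : ℝ) ^ (1 - β₂ * α)))
      (atTop ×ˢ atTop)
      (nhds ((∑' i : ℕ, winf i ^ (α - 1) * (1 + (i : ℝ)) ^ (-(β₁ * (α - 1)))) *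
        ∫ u in Ioi (0 : ℝ), u ^ (-(β₂ * (α - 1))) * (1 + u) ^ (-β₂))) := by
  classical
  have hα0 : 0 < α - 1 := by linarith
  have hb1 : 1 < β₁ * (α - 1) := by rwa [div_lt_iff₀ hα0] at hβ₁
  have hb2 : β₂ * (α - 1) < 1 := by rwa [lt_div_iff₀ hα0] at hβ₂u
  have hb3 : 1 < β₂ * α := by rwa [div_lt_iff₀ (by linarith)] at hβ₂l
  have hβ₁0 : 0 < β₁ := lt_trans (by positivity) hβ₁
  have hβ₂0 : 0 < β₂ := lt_trans (by positivity) hβ₂l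
  obtain ⟨M, hM0, hM⟩ := aux_bdd w hA1 winf (fun i => (hA2 i).1) wco (fun j => (hA3 j).1)
  -- normalised quantities
  let X : ℕ → ℕ → ℕ → ℝ := fun m i j =>
    w i j * (1 + (i:ℝ)) ^ (-β₁) * ((1 + (j:ℝ)) / m) ^ (-β₂)
  let Y : ℕ → ℕ → ℕ → ℕ → ℝ := fun n m i j =>
    w (i+n) (j+m) * ((1 + (i:ℝ) + n) / n) ^ (-β₁) * ((1 + (j:ℝ) + m) / m) ^ (-β₂)
  have hX0 : ∀ m i j, 1 ≤ m → X m i j ≠ 0 := by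
    intro m i j hm
    have hm' : (0:ℝ) < m := by exact_mod_cast hm
    have := hw i j
    simp only [X]
    positivity
  have hcX : ∀ m i j, 1 ≤ m → c i j = X m i j / (m:ℝ) ^ β₂ := by
    intro m i j hm
    have hm' : (0:ℝ) < m := by exact_mod_cast hm
    simp only [X]
    rw [hc, div_rpow (by positivity) hm'.le, rpow_neg hm'.le]
    have : 0 < (m:ℝ) ^ β₂ := by positivity
    field_simp
  have hcY : ∀ n m i j, 1 ≤ n → 1 ≤ m →
      c (i+n) (j+m) = Y n m i j / ((m:ℝ) ^ β₂ * (n:ℝ) ^ β₁) := by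
    intro n m i j hn hm
    have hm' : (0:ℝ) < m := by exact_mod_cast hm
    have hn' : (0:ℝ) < n := by exact_mod_cast hn
    simp only [Y]
    rw [hc, div_rpow (by positivity) hm'.le, div_rpow (by positivity) hn'.le,
      rpow_neg hm'.le, rpow_neg hn'.le]
    have : 0 < (m:ℝ) ^ β₂ := by positivity
    have : 0 < (n:ℝ) ^ β₁ := by positivity
    push_cast
    rw [add_assoc, add_assoc]
    field_simp
  let G : ℕ × ℕ → ℕ → ℕ → ℝ := fun p i j =>
    ((p.2:ℝ) ^ β₂) ^ α * (p.1:ℝ) ^ β₁ * V α (c i j) (c (i+p.1) (j+p.2))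
  let g : ℝ → ℝ := fun v => v ^ (-(β₂ * (α - 1))) * (1 + v) ^ (-β₂)
  have hg : IntegrableOn g (Ioi 0) := aux_int _ _ hb2 hβ₂0.le (by linarith)
  let D : ℕ → ℝ := fun i => (M ^ (α - 1) * M) * (1 + (i:ℝ)) ^ (-(β₁ * (α - 1)))
  have hD : Summable D := by
    refine Summable.mul_left _ ?_
    have := (summable_nat_add_iff 1).2 (Real.summable_nat_rpow.2 (by linarith : -(β₁ * (α-1)) < -1))
    refine this.congr fun i => ?_
    push_cast
    rw [add_comm]
  have hGle : ∀ n m i, 1 ≤ n → 1 ≤ m → ∀ v : ℝ, 0 < v →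
      |G (n, m) i ⌊(m:ℝ) * v⌋₊| ≤ D i * g v := by
    intro n m i hn hm v hv
    have hm' : (0:ℝ) < m := by exact_mod_cast hm
    have hn' : (0:ℝ) < n := by exact_mod_cast hn
    simp only [G]
    rw [hcY n m i _ hn hm, hcX m i _ hm]
    refine (aux_V_le α _ _ _ _ hα2 (by positivity) (hX0 _ _ _ hm)).trans ?_
    have hj := (Nat.lt_floor_add_one ((m:ℝ) * v)).le
    set j := ⌊(m:ℝ) * v⌋₊
    have q1 : v ≤ (1 + (j:ℝ)) / m := by
      rw [le_div_iff₀ hm']; linarith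
    have q2 : 1 + v ≤ (1 + (j:ℝ) + m) / m := by
      rw [le_div_iff₀ hm']; linarith
    have q3 : 1 ≤ (1 + (i:ℝ) + n) / n := by
      rw [le_div_iff₀ hn']; have : (0:ℝ) ≤ i := Nat.cast_nonneg i
      linarith
    have r1 : |X m i j| ≤ M * (1 + (i:ℝ)) ^ (-β₁) * v ^ (-β₂) := by
      simp only [X]
      rw [abs_mul, abs_mul, abs_of_nonneg (by positivity : 0 ≤ (1 + (i:ℝ)) ^ (-β₁)),
        abs_of_nonneg (by positivity : 0 ≤ ((1 + (j:ℝ)) / m) ^ (-β₂))]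
      have := rpow_le_rpow_of_nonpos hv q1 (by linarith : -β₂ ≤ 0)
      have := hM i j
      gcongr
    have r2 : |Y n m i j| ≤ M * (1 + v) ^ (-β₂) := by
      simp only [Y]
      rw [abs_mul, abs_mul, abs_of_nonneg (by positivity : 0 ≤ ((1 + (i:ℝ) + n) / n) ^ (-β₁)),
        abs_of_nonneg (by positivity : 0 ≤ ((1 + (j:ℝ) + m) / m) ^ (-β₂))]
      have t1 := rpow_le_rpow_of_nonpos (by linarith) q2 (by linarith : -β₂ ≤ 0)
      have t2 := rpow_le_one_of_one_le_of_nonpos q3 (by linarith : -β₁ ≤ 0)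
      have t3 := hM (i+n) (j+m)
      have t4 : |w (i+n) (j+m)| * ((1 + (i:ℝ) + n) / n) ^ (-β₁) ≤ M * 1 := by gcongr
      rw [mul_one] at t4
      gcongr
    have r3 : |X m i j| ^ (α - 1) ≤ (M * (1 + (i:ℝ)) ^ (-β₁) * v ^ (-β₂)) ^ (α - 1) :=
      rpow_le_rpow (abs_nonneg _) r1 hα0.le
    rw [mul_rpow (by positivity) (by positivity), mul_rpow (by positivity) (by positivity),
      ← rpow_mul (by positivity), ← rpow_mul (by positivity)] at r3
    calc _ ≤ (M ^ (α-1) * (1 + (i:ℝ)) ^ (-β₁ * (α - 1)) * v ^ (-β₂ * (α - 1))) *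
            (M * (1 + v) ^ (-β₂)) := by gcongr
      _ = D i * g v := by
        simp only [D, g, neg_mul]; ring
  have hmeas : ∀ p i, Measurable (fun v : ℝ => G p i ⌊(p.2:ℝ) * v⌋₊) := by
    intro p i
    exact (measurable_from_nat (f := G p i)).comp (Nat.measurable_floor.comp (by fun_prop))
  have hGint : ∀ n m i, 1 ≤ n → 1 ≤ m →
      IntegrableOn (fun v : ℝ => G (n, m) i ⌊(m:ℝ) * v⌋₊) (Ioi 0) := by
    intro n m i hn hm
    refine Integrable.mono' (hg.const_mul (D i)) (hmeas (n, m) i).aestronglyMeasurable ?_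
    exact (ae_restrict_iff' measurableSet_Ioi).2
      (Eventually.of_forall fun v hv => hGle n m i hn hm v hv)
  have hev : ∀ᶠ p : ℕ × ℕ in atTop ×ˢ atTop, 1 ≤ p.1 ∧ 1 ≤ p.2 :=
    (eventually_ge_atTop 1).prod_mk (eventually_ge_atTop 1)
  have hpt : ∀ i, ∀ v : ℝ, 0 < v → Tendsto (fun p : ℕ × ℕ => G p i ⌊(p.2:ℝ) * v⌋₊)
      (atTop ×ˢ atTop)
      (nhds ((winf i ^ (α - 1) * (1 + (i : ℝ)) ^ (-(β₁ * (α - 1)))) * g v)) := by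
    intro i v hv
    have hfst : Tendsto (fun p : ℕ × ℕ => p.1) (atTop ×ˢ atTop) atTop := tendsto_fst
    have hsnd : Tendsto (fun p : ℕ × ℕ => p.2) (atTop ×ˢ atTop) atTop := tendsto_snd
    have hn : Tendsto (fun p : ℕ × ℕ => (p.1:ℝ)) (atTop ×ˢ atTop) atTop :=
      tendsto_natCast_atTop_atTop.comp hfst
    have hm : Tendsto (fun p : ℕ × ℕ => (p.2:ℝ)) (atTop ×ˢ atTop) atTop :=
      tendsto_natCast_atTop_atTop.comp hsnd
    have hj : Tendsto (fun p : ℕ × ℕ => ⌊(p.2:ℝ) * v⌋₊) (atTop ×ˢ atTop) atTop :=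
      tendsto_nat_floor_atTop.comp (hm.atTop_mul_const hv)
    have hjm : Tendsto (fun p : ℕ × ℕ => (⌊(p.2:ℝ) * v⌋₊ : ℝ) / p.2) (atTop ×ˢ atTop) (nhds v) := by
      have := (tendsto_nat_floor_mul_div_atTop (R := ℝ) hv.le).comp hm
      refine this.congr fun p => ?_
      simp [mul_comm]
    have hminv : Tendsto (fun p : ℕ × ℕ => (p.2:ℝ)⁻¹) (atTop ×ˢ atTop) (nhds 0) :=
      tendsto_inv_atTop_zero.comp hm
    have hninv : Tendsto (fun p : ℕ × ℕ => (p.1:ℝ)⁻¹) (atTop ×ˢ atTop) (nhds 0) :=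
      tendsto_inv_atTop_zero.comp hn
    have l1 : Tendsto (fun p : ℕ × ℕ => (1 + (⌊(p.2:ℝ) * v⌋₊ : ℝ)) / p.2)
        (atTop ×ˢ atTop) (nhds v) := by
      have := hminv.add hjm
      rw [zero_add] at this
      refine this.congr fun p => ?_
      rw [add_div, one_div]
    have l2 : Tendsto (fun p : ℕ × ℕ => (1 + (⌊(p.2:ℝ) * v⌋₊ : ℝ) + p.2) / p.2)
        (atTop ×ˢ atTop) (nhds (1 + v)) := by
      have := l1.const_add 1
      refine this.congr' ?_
      filter_upwards [hev] with p hp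
      have : (0:ℝ) < p.2 := by exact_mod_cast hp.2
      field_simp
      ring
    have l3 : Tendsto (fun p : ℕ × ℕ => (1 + (i:ℝ) + p.1) / p.1)
        (atTop ×ˢ atTop) (nhds 1) := by
      have := (hninv.const_mul (1 + (i:ℝ))).add_const 1
      rw [mul_zero, zero_add] at this
      refine this.congr' ?_
      filter_upwards [hev] with p hp
      have : (0:ℝ) < p.1 := by exact_mod_cast hp.1
      field_simp
    have lw1 : Tendsto (fun p : ℕ × ℕ => w i ⌊(p.2:ℝ) * v⌋₊) (atTop ×ˢ atTop) (nhds (winf i)) :=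
      (hA2 i).1.comp hj
    have lw2 : Tendsto (fun p : ℕ × ℕ => w (i + p.1) (⌊(p.2:ℝ) * v⌋₊ + p.2))
        (atTop ×ˢ atTop) (nhds 1) := by
      refine hA1.comp (f := fun p : ℕ × ℕ => (i + p.1, ⌊(p.2:ℝ) * v⌋₊ + p.2)) ?_
      exact Tendsto.prodMk (tendsto_atTop_mono (fun p => Nat.le_add_left _ _) hfst)
        (tendsto_atTop_mono (fun p => Nat.le_add_left _ _) hsnd)
    have hw0 := (hA2 i).2
    have lX : Tendsto (fun p : ℕ × ℕ => X p.2 i ⌊(p.2:ℝ) * v⌋₊) (atTop ×ˢ atTop)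
        (nhds (winf i * (1 + (i:ℝ)) ^ (-β₁) * v ^ (-β₂))) :=
      (lw1.mul_const _).mul (l1.rpow_const (Or.inl hv.ne'))
    have lY : Tendsto (fun p : ℕ × ℕ => Y p.1 p.2 i ⌊(p.2:ℝ) * v⌋₊) (atTop ×ˢ atTop)
        (nhds (1 * 1 ^ (-β₁) * (1 + v) ^ (-β₂))) :=
      (lw2.mul (l3.rpow_const (Or.inl one_ne_zero))).mul (l2.rpow_const (Or.inl (by positivity)))
    rw [one_rpow, one_mul, one_mul] at lY
    set X0 := winf i * (1 + (i:ℝ)) ^ (-β₁) * v ^ (-β₂) with hX0def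
    have hX0p : 0 < X0 := by positivity
    have lQ : Tendsto (fun p : ℕ × ℕ => (p.1:ℝ) ^ β₁) (atTop ×ˢ atTop) atTop :=
      (tendsto_rpow_atTop hβ₁0).comp hn
    have lR := (lY.div_atTop lQ).div lX hX0p.ne'
    have lT := ((lR.pow 2).const_add 1).rpow_const (p := -((2 - α) / 2)) (Or.inl (by simp))
    have lA := ((lX.abs.rpow_const (p := α - 2) (Or.inl (abs_pos.2 hX0p.ne').ne')).mul lX).mul lY |>.mul lT
    have elim : |X0| ^ (α - 2) * X0 * (1 + v) ^ (-β₂) * (1 + (0 / X0) ^ 2) ^ (-((2 - α) / 2)) =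
        (winf i ^ (α - 1) * (1 + (i : ℝ)) ^ (-(β₁ * (α - 1)))) * g v := by
      rw [abs_of_pos hX0p, ← rpow_add_one hX0p.ne', (by ring : α - 2 + 1 = α - 1), hX0def,
        mul_rpow (by positivity) (by positivity), mul_rpow (by positivity) (by positivity),
        ← rpow_mul (by positivity), ← rpow_mul (by positivity)]
      simp only [g, neg_mul]
      simp
      ring
    rw [elim] at lA
    refine lA.congr' ?_
    filter_upwards [hev] with p hp
    have hm' : (0:ℝ) < p.2 := by exact_mod_cast hp.2
    have hn' : (0:ℝ) < p.1 := by exact_mod_cast hp.1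
    simp only [G]
    rw [hcY p.1 p.2 i _ hp.1 hp.2, hcX p.2 i _ hp.2, aux_V α _ _ _ _ (by positivity) (hX0 _ _ _ hp.2),
      if_neg (by positivity)]
    rfl
  have hI : ∀ i, Tendsto (fun p : ℕ × ℕ => ∫ v in Ioi (0:ℝ), G p i ⌊(p.2:ℝ) * v⌋₊)
      (atTop ×ˢ atTop)
      (nhds ((winf i ^ (α - 1) * (1 + (i : ℝ)) ^ (-(β₁ * (α - 1)))) * ∫ v in Ioi (0:ℝ), g v)) := by
    intro i
    rw [← integral_const_mul]
    refine tendsto_integral_filter_of_dominated_convergence (fun v => D i * g v)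
      (Eventually.of_forall fun p => (hmeas p i).aestronglyMeasurable) ?_ (hg.const_mul _) ?_
    · filter_upwards [hev] with p hp
      exact (ae_restrict_iff' measurableSet_Ioi).2
        (Eventually.of_forall fun v hv => hGle p.1 p.2 i hp.1 hp.2 v hv)
    · exact (ae_restrict_iff' measurableSet_Ioi).2
        (Eventually.of_forall fun v hv => hpt i v hv)
  have hS := tendsto_tsum_of_dominated_convergence (𝓕 := (atTop ×ˢ atTop : Filter (ℕ × ℕ)))
    (f := fun p i => ∫ v in Ioi (0:ℝ), G p i ⌊(p.2:ℝ) * v⌋₊)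
    (bound := fun i => D i * ∫ v in Ioi (0:ℝ), g v) (hD.mul_right _) hI (by
      filter_upwards [hev] with p hp i
      rw [← integral_const_mul]
      exact norm_integral_le_of_norm_le (hg.const_mul _) ((ae_restrict_iff' measurableSet_Ioi).2
        (Eventually.of_forall fun v hv => hGle p.1 p.2 i hp.1 hp.2 v hv)))
  rw [tsum_mul_right] at hS
  refine hS.congr' ?_
  filter_upwards [hev] with p hp
  have hm' : (0:ℝ) < p.2 := by exact_mod_cast hp.2
  have hn' : (0:ℝ) < p.1 := by exact_mod_cast hp.1
  rw [hρ p.1 p.2 hp.1 hp.2, ← tsum_div_const]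
  refine tsum_congr fun i => ?_
  have h := aux_floor (G p i) p.2 hm' (hGint p.1 p.2 i hp.1 hp.2)
  simp only [G] at h ⊢
  rw [tsum_mul_left] at h
  rw [← mul_right_inj' hm'.ne', ← h, rpow_sub hm', rpow_one, rpow_neg hn'.le, ← rpow_mul hm'.le]
  have : 0 < (p.1:ℝ) ^ β₁ := by positivity
  have : 0 < (p.2:ℝ) ^ (β₂ * α) := by positivity
  field_simp
end

section
/- Let 1 < α ≤ 2, β₁ = 1/(α−1) and 1/α < β₂ < 1/(α−1). Then the doubly-indexed limit, as n → ∞ and m → ∞ (along the product filter), of ρ(n,m)/(n^{−β₁} m^{1−β₂α} ln n) exists and equals ∫₀^∞ v^{−β₂(α−1)} (1+v)^{−β₂} dv. -/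
open Filter MeasureTheory Real Set

lemma V_abs_le {α x y : ℝ} (hα2 : α ≤ 2) (hx : x ≠ 0) : |V α x y| ≤ |x| ^ (α - 1) * |y| := by
  have hx0 : 0 < |x| := abs_pos.mpr hx
  have h1 : |x| ^ (2 - α) ≤ (x ^ 2 + y ^ 2) ^ ((2 - α) / 2) := by
    have : |x| ^ (2 - α) = (x ^ 2) ^ ((2 - α) / 2) := by
      rw [← sq_abs, ← Real.rpow_natCast, ← Real.rpow_mul hx0.le]
      congr 1
      push_cast
      ring
    rw [this]
    exact Real.rpow_le_rpow (by positivity) (by nlinarith [sq_nonneg y]) (by linarith)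
  have h2 : 0 < |x| ^ (2 - α) := Real.rpow_pos_of_pos hx0 _
  have h3 : |x| ^ (α - 1) = |x| / |x| ^ (2 - α) := by
    rw [show α - 1 = 1 - (2 - α) by ring, Real.rpow_sub hx0, Real.rpow_one]
  simp only [V, hx, false_and, if_false]
  rw [abs_div, abs_mul, abs_of_nonneg (h2.le.trans h1), h3, div_mul_eq_mul_div]
  gcongr

lemma V_ge {α x y : ℝ} (hα : 0 ≤ α) (hα2 : α ≤ 2) (hx : 0 < x) (hy : 0 < y) :
    x ^ (α - 1) * y * (1 - (y / x) ^ 2) ≤ V α x y := by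
  set u := (y / x) ^ 2 with hu
  have hu0 : 0 < u := by positivity
  have e : x ^ 2 + y ^ 2 = x ^ 2 * (1 + u) := by rw [hu]; field_simp
  have h3 : x ^ (α - 1) = x / x ^ (2 - α) := by
    rw [show α - 1 = 1 - (2 - α) by ring, Real.rpow_sub hx, Real.rpow_one]
  have h4 : (x ^ 2) ^ ((2 - α) / 2) = x ^ (2 - α) := by
    rw [← Real.rpow_natCast, ← Real.rpow_mul hx.le]
    congr 1
    push_cast
    ring
  have h5 : (1 + u) ^ ((2 - α) / 2) ≤ 1 + u := by
    calc _ ≤ (1 + u) ^ (1 : ℝ) := Real.rpow_le_rpow_of_exponent_le (by linarith) (by linarith)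
      _ = _ := Real.rpow_one _
  have h6 : 0 < (1 + u) ^ ((2 - α) / 2) := by positivity
  have h7 : (1 - u) ≤ 1 / (1 + u) ^ ((2 - α) / 2) := by
    calc 1 - u ≤ 1 / (1 + u) := by rw [le_div_iff₀ (by linarith)]; nlinarith
      _ ≤ _ := by gcongr
  simp only [V, hx.ne', false_and, if_false]
  rw [e, Real.mul_rpow (by positivity) (by positivity), h4, h3]
  have h8 : 0 < x ^ (2 - α) := by positivity
  calc x / x ^ (2 - α) * y * (1 - u) ≤ x / x ^ (2 - α) * y * (1 / (1 + u) ^ ((2 - α) / 2)) := by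
        gcongr
    _ = _ := by field_simp

/-- crude bound -/
lemma V_crude {α K w w' x y : ℝ} (hα : 1 < α) (hα2 : α ≤ 2) (hK : 0 ≤ K) (hw : w ≠ 0)
    (hwK : |w| ≤ K) (hwK' : |w'| ≤ K) (hx : 0 < x) (hy : 0 < y) :
    |V α (w * x) (w' * y) - x ^ (α - 1) * y| ≤ (K ^ (α - 1) * K + 1) * (x ^ (α - 1) * y) := by
  have h := V_abs_le (y := w' * y) hα2 (mul_ne_zero hw hx.ne')
  have hp : 0 < x ^ (α - 1) * y := by positivity
  rw [abs_mul, abs_mul, abs_of_pos hx, abs_of_pos hy, Real.mul_rpow (abs_nonneg _) hx.le] at h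
  have h2 : |w| ^ (α - 1) * |w'| ≤ K ^ (α - 1) * K := by
    gcongr
  calc _ ≤ |V α (w * x) (w' * y)| + |x ^ (α - 1) * y| := abs_sub _ _
    _ ≤ (|w| ^ (α - 1) * |w'|) * (x ^ (α - 1) * y) + x ^ (α - 1) * y := by
        rw [abs_of_pos hp]; linarith
    _ ≤ (K ^ (α - 1) * K) * (x ^ (α - 1) * y) + x ^ (α - 1) * y := by gcongr
    _ = _ := by ring

lemma V_fine {α ε w w' x y : ℝ} (hα : 1 < α) (hα2 : α ≤ 2) (hε : ε ≤ 1)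
    (hw : 1 / 2 ≤ w) (hw0 : 0 < w') (hw' : w' ≤ 2) (hww : |w ^ (α - 1) * w' - 1| ≤ ε)
    (hx : 0 < x) (hy : 0 < y) :
    |V α (w * x) (w' * y) - x ^ (α - 1) * y| ≤ (ε + 32 * (y / x) ^ 2) * (x ^ (α - 1) * y) := by
  have hw1 : 0 < w := by linarith
  have h1 := V_ge (α := α) (by linarith) hα2 (mul_pos hw1 hx) (mul_pos hw0 hy)
  have h2 := (le_abs_self _).trans
    (V_abs_le (y := w' * y) hα2 (mul_pos hw1 hx).ne')
  rw [abs_of_pos (mul_pos hw1 hx), abs_of_pos (mul_pos hw0 hy)] at h2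
  rw [Real.mul_rpow hw1.le hx.le] at h1 h2
  set κ := w ^ (α - 1) * w' with hκ
  set Q := x ^ (α - 1) * y with hQ
  have hQ0 : 0 < Q := by positivity
  have hκ0 : 0 < κ := by positivity
  have e : w ^ (α - 1) * x ^ (α - 1) * (w' * y) = κ * Q := by rw [hκ, hQ]; ring
  rw [e] at h1 h2
  have h3 : (w' * y / (w * x)) ^ 2 ≤ 16 * (y / x) ^ 2 := by
    rw [mul_div_mul_comm, mul_pow]
    gcongr
    have : w' / w ≤ 4 := by rw [div_le_iff₀ hw1]; linarith
    have h0 : 0 < w' / w := by positivity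
    nlinarith
  obtain ⟨k1, k2⟩ := abs_le.mp hww
  have hκ2 : κ ≤ 2 := by linarith
  have h4 : κ * Q * (w' * y / (w * x)) ^ 2 ≤ 2 * Q * (16 * (y / x) ^ 2) := by gcongr
  have h5 : 0 ≤ (y / x) ^ 2 := sq_nonneg _
  have h6 := mul_nonneg h5 hQ0.le
  rw [abs_le]
  constructor <;> nlinarith

lemma hasSum_tele {g : ℕ → ℝ} (hg : Antitone g) (h0 : Tendsto g atTop (nhds 0)) :
    HasSum (fun i => g i - g (i + 1)) (g 0) := by
  rw [hasSum_iff_tendsto_nat_of_nonneg (fun i => sub_nonneg.mpr (hg (Nat.le_succ i)))]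
  simp_rw [Finset.sum_range_sub']
  simpa using h0.const_sub (g 0)

lemma tele_anti (n : ℕ) : Antitone (fun i : ℕ => 1 / (1 + (i : ℝ) + n)) := by
  intro i j hij
  have : (i : ℝ) ≤ j := by exact_mod_cast hij
  dsimp only
  gcongr

lemma tele_lim (n : ℕ) : Tendsto (fun i : ℕ => 1 / (1 + (i : ℝ) + n)) atTop (nhds 0) := by
  have := (tendsto_one_div_atTop_nhds_zero_nat (𝕜 := ℝ)).comp (tendsto_add_atTop_nat (1 + n))
  refine this.congr (fun i => ?_)
  simp only [Function.comp]
  push_cast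
  ring_nf

lemma hasSum_harm (n : ℕ) :
    HasSum (fun i : ℕ => 1 / (1 + (i : ℝ)) - 1 / (1 + (i : ℝ) + n)) (harmonic n : ℝ) := by
  induction n with
  | zero => simp
  | succ n ih =>
    have h := hasSum_tele (tele_anti n) (tele_lim n)
    have h2 := ih.add h
    have e : (harmonic n : ℝ) + 1 / (1 + ((0 : ℕ) : ℝ) + n) = (harmonic (n + 1) : ℝ) := by
      rw [harmonic_succ]
      push_cast
      simp
      ring
    rw [e] at h2
    refine h2.congr_fun ?_ |> id
    intro i
    push_cast
    ring_nf

lemma hasSum_sq (n : ℕ) (hn : 1 ≤ n) :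
    Summable (fun i : ℕ => (n : ℝ) / (1 + (i : ℝ) + n) ^ 2) ∧
    ∑' i : ℕ, (n : ℝ) / (1 + (i : ℝ) + n) ^ 2 ≤ 1 := by
  obtain ⟨k, rfl⟩ : ∃ k, n = k + 1 := ⟨n - 1, by omega⟩
  have h := (hasSum_tele (tele_anti k) (tele_lim k)).mul_left ((k + 1 : ℕ) : ℝ)
  have hle : ∀ i : ℕ, ((k + 1 : ℕ) : ℝ) / (1 + (i : ℝ) + (k + 1 : ℕ)) ^ 2 ≤
      ((k + 1 : ℕ) : ℝ) * (1 / (1 + (i : ℝ) + k) - 1 / (1 + ((i + 1 : ℕ) : ℝ) + k)) := by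
    intro i
    rw [div_eq_mul_one_div]
    gcongr
    push_cast
    rw [div_sub_div _ _ (by positivity) (by positivity), div_le_div_iff₀ (by positivity) (by positivity)]
    have : (0 : ℝ) ≤ i := by positivity
    have : (0 : ℝ) ≤ k := by positivity
    nlinarith
  have hs := Summable.of_nonneg_of_le (fun i => by positivity) hle h.summable
  refine ⟨hs, (hs.tsum_le_tsum hle h.summable).trans ?_⟩
  rw [h.tsum_eq]
  push_cast
  apply le_of_eq
  field_simp
  ring

lemma U_bounds {β : ℝ} (hβ : 1 ≤ β) (n : ℕ) (hn : 1 ≤ n) :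
    Summable (fun i : ℕ => (1 + (i : ℝ))⁻¹ * ((n : ℝ) / (1 + i + n)) ^ β) ∧
    (harmonic n : ℝ) - β ≤ ∑' i : ℕ, (1 + (i : ℝ))⁻¹ * ((n : ℝ) / (1 + i + n)) ^ β ∧
    ∑' i : ℕ, (1 + (i : ℝ))⁻¹ * ((n : ℝ) / (1 + i + n)) ^ β ≤ (harmonic n : ℝ) := by
  have hn' : (0 : ℝ) < n := by exact_mod_cast hn
  have hx0 : ∀ i : ℕ, 0 < (n : ℝ) / (1 + i + n) := fun i => by positivity
  have hx1 : ∀ i : ℕ, (n : ℝ) / (1 + i + n) ≤ 1 := fun i => by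
    rw [div_le_one (by positivity)]
    have : (0 : ℝ) ≤ i := by positivity
    linarith
  have hT : ∀ i : ℕ, 1 / (1 + (i : ℝ)) - 1 / (1 + (i : ℝ) + n) =
      (1 + (i : ℝ))⁻¹ * ((n : ℝ) / (1 + i + n)) := fun i => by
    field_simp
    ring
  have hH := hasSum_harm n
  simp_rw [hT] at hH
  have hle : ∀ i : ℕ, (1 + (i : ℝ))⁻¹ * ((n : ℝ) / (1 + i + n)) ^ β ≤
      (1 + (i : ℝ))⁻¹ * ((n : ℝ) / (1 + i + n)) := fun i => by
    gcongr
    calc _ ≤ ((n : ℝ) / (1 + i + n)) ^ (1 : ℝ) :=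
          Real.rpow_le_rpow_of_exponent_ge (hx0 i) (hx1 i) hβ
      _ = _ := Real.rpow_one _
  have hs : Summable (fun i : ℕ => (1 + (i : ℝ))⁻¹ * ((n : ℝ) / (1 + i + n)) ^ β) :=
    Summable.of_nonneg_of_le (fun i => by positivity) hle hH.summable
  obtain ⟨s1, s2⟩ := hasSum_sq n hn
  refine ⟨hs, ?_, hH.tsum_eq ▸ hs.tsum_le_tsum hle hH.summable⟩
  have hd : ∀ i : ℕ, (1 + (i : ℝ))⁻¹ * ((n : ℝ) / (1 + i + n)) ≤
      (1 + (i : ℝ))⁻¹ * ((n : ℝ) / (1 + i + n)) ^ β + β * ((n : ℝ) / (1 + (i : ℝ) + n) ^ 2) := by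
    intro i
    have e : β * ((n : ℝ) / (1 + (i : ℝ) + n) ^ 2) = (1 + (i : ℝ))⁻¹ *
        (((n : ℝ) / (1 + i + n)) * (β * (1 - (n : ℝ) / (1 + i + n)))) := by
      field_simp
      ring
    rw [e, ← mul_add]
    set x := (n : ℝ) / (1 + i + n)
    have hx := hx0 i
    have hx' := hx1 i
    gcongr
    have hb := one_add_mul_self_le_rpow_one_add (s := x - 1) (by linarith [hx0 i]) hβ
    rw [show 1 + (x - 1) = x by ring] at hb
    have e1 : x ^ β = x * x ^ (β - 1) := by
      have h := Real.rpow_add (show 0 < x from hx0 i) 1 (β - 1)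
      rw [Real.rpow_one] at h
      rw [← h]
      congr 1
      ring
    have h1 : x ^ β ≤ x ^ (β - 1) := Real.rpow_le_rpow_of_exponent_ge (hx0 i) (hx1 i) (by linarith)
    rw [e1]
    nlinarith [hx0 i]
  have hS := hs.add (s1.mul_left β)
  have := hH.summable.tsum_le_tsum hd hS
  rw [hs.tsum_add (s1.mul_left β), tsum_mul_left, hH.tsum_eq] at this
  nlinarith

lemma a_eq {β : ℝ} (n : ℕ) (hn : 1 ≤ n) (i : ℕ) :
    (1 + (i : ℝ))⁻¹ * (1 + i + n) ^ (-β) =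
      (n : ℝ) ^ (-β) * ((1 + (i : ℝ))⁻¹ * ((n : ℝ) / (1 + i + n)) ^ β) := by
  have hn' : (0 : ℝ) < n := by exact_mod_cast hn
  rw [Real.div_rpow hn'.le (by positivity), Real.rpow_neg (by positivity), Real.rpow_neg hn'.le]
  field_simp

lemma a_summable {β : ℝ} (hβ : 1 ≤ β) (n : ℕ) (hn : 1 ≤ n) :
    Summable (fun i : ℕ => (1 + (i : ℝ))⁻¹ * (1 + i + n) ^ (-β)) := by
  simp_rw [a_eq n hn]
  exact (U_bounds hβ n hn).1.mul_left _

lemma log_lim : Tendsto (fun n : ℕ => Real.log n) atTop atTop :=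
  Real.tendsto_log_atTop.comp tendsto_natCast_atTop_atTop

lemma a_tendsto {β : ℝ} (hβ : 1 ≤ β) :
    Tendsto (fun n : ℕ => (∑' i : ℕ, (1 + (i : ℝ))⁻¹ * (1 + i + n) ^ (-β)) /
      ((n : ℝ) ^ (-β) * Real.log n)) atTop (nhds 1) := by
  have hl : ∀ C : ℝ, Tendsto (fun n : ℕ => 1 + C / Real.log n) atTop (nhds 1) := fun C => by
    simpa using (log_lim.const_div_atTop C).const_add 1
  have hev : ∀ᶠ n : ℕ in atTop, 1 ≤ n ∧ 0 < Real.log n :=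
    (eventually_ge_atTop 1).and (log_lim.eventually_gt_atTop 0)
  have key : ∀ n : ℕ, 1 ≤ n → 0 < Real.log n →
      (∑' i : ℕ, (1 + (i : ℝ))⁻¹ * (1 + i + n) ^ (-β)) / ((n : ℝ) ^ (-β) * Real.log n) =
      (∑' i : ℕ, (1 + (i : ℝ))⁻¹ * ((n : ℝ) / (1 + i + n)) ^ β) / Real.log n := by
    intro n hn hl
    have hn' : (0 : ℝ) < n := by exact_mod_cast hn
    simp_rw [a_eq n hn]
    rw [tsum_mul_left, mul_div_mul_left _ _ (by positivity)]
  refine tendsto_of_tendsto_of_tendsto_of_le_of_le' (hl (-β)) (hl 1) ?_ ?_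
  · filter_upwards [hev] with n ⟨hn, hl⟩
    rw [key n hn hl, le_div_iff₀ hl, add_mul, div_mul_cancel₀ _ hl.ne']
    have := log_add_one_le_harmonic n
    have h2 : Real.log n ≤ Real.log (n + 1 : ℕ) := by
      apply Real.log_le_log
      · exact_mod_cast hn
      · push_cast; linarith
    linarith [(U_bounds hβ n hn).2.1]
  · filter_upwards [hev] with n ⟨hn, hl⟩
    rw [key n hn hl, div_le_iff₀ hl, add_mul, div_mul_cancel₀ _ hl.ne']
    linarith [(U_bounds hβ n hn).2.2, harmonic_le_one_add_log n]

lemma a'_bound {β : ℝ} (hβ : 1 ≤ β) (n : ℕ) (hn : 1 ≤ n) :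
    Summable (fun i : ℕ => (1 + (i : ℝ))⁻¹ * (1 + i + n) ^ (-β) * ((1 + i) / (1 + i + n))) ∧
    ∑' i : ℕ, (1 + (i : ℝ))⁻¹ * (1 + i + n) ^ (-β) * ((1 + i) / (1 + i + n)) ≤ (n : ℝ) ^ (-β) := by
  obtain ⟨s1, s2⟩ := hasSum_sq n hn
  have hn' : (0 : ℝ) < n := by exact_mod_cast hn
  have hle : ∀ i : ℕ, (1 + (i : ℝ))⁻¹ * (1 + i + n) ^ (-β) * ((1 + i) / (1 + i + n)) ≤
      (n : ℝ) ^ (-β) * ((n : ℝ) / (1 + (i : ℝ) + n) ^ 2) := by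
    intro i
    rw [a_eq n hn, mul_assoc]
    gcongr
    have hx1 : (n : ℝ) / (1 + i + n) ≤ 1 := by
      rw [div_le_one (by positivity)]
      have : (0 : ℝ) ≤ i := by positivity
      linarith
    have : ((n : ℝ) / (1 + i + n)) ^ β ≤ (n : ℝ) / (1 + i + n) := by
      calc _ ≤ ((n : ℝ) / (1 + i + n)) ^ (1 : ℝ) :=
            Real.rpow_le_rpow_of_exponent_ge (by positivity) hx1 hβ
        _ = _ := Real.rpow_one _
    calc _ ≤ (1 + (i : ℝ))⁻¹ * ((n : ℝ) / (1 + i + n)) * ((1 + i) / (1 + i + n)) := by gcongr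
      _ = _ := by field_simp
  have hs := Summable.of_nonneg_of_le (fun i => by positivity) hle (s1.mul_left _)
  refine ⟨hs, (hs.tsum_le_tsum hle (s1.mul_left _)).trans ?_⟩
  rw [tsum_mul_left]
  exact mul_le_of_le_one_right (by positivity) s2

lemma a'_tendsto {β : ℝ} (hβ : 1 ≤ β) :
    Tendsto (fun n : ℕ => (∑' i : ℕ, (1 + (i : ℝ))⁻¹ * (1 + i + n) ^ (-β) *
      ((1 + i) / (1 + i + n))) / ((n : ℝ) ^ (-β) * Real.log n)) atTop (nhds 0) := by
  refine tendsto_of_tendsto_of_tendsto_of_le_of_le' tendsto_const_nhds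
    (log_lim.const_div_atTop 1) ?_ ?_
  · filter_upwards [log_lim.eventually_gt_atTop 0] with n hl
    exact div_nonneg (tsum_nonneg fun i => by positivity) (by positivity)
  · filter_upwards [log_lim.eventually_gt_atTop 0, eventually_ge_atTop 1] with n hl hn
    have hn' : (0 : ℝ) < n := by exact_mod_cast hn
    rw [div_le_div_iff₀ (by positivity) hl, one_mul]
    gcongr
    exact (a'_bound hβ n hn).2

lemma aN_tendsto {β : ℝ} (hβ : 1 ≤ β) (N : ℕ) :
    Tendsto (fun n : ℕ => (∑ i ∈ Finset.range N, (1 + (i : ℝ))⁻¹ * (1 + i + n) ^ (-β)) /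
      ((n : ℝ) ^ (-β) * Real.log n)) atTop (nhds 0) := by
  refine tendsto_of_tendsto_of_tendsto_of_le_of_le' tendsto_const_nhds
    (log_lim.const_div_atTop N) ?_ ?_
  · filter_upwards [log_lim.eventually_gt_atTop 0] with n hl
    exact div_nonneg (Finset.sum_nonneg fun i _ => by positivity) (by positivity)
  · filter_upwards [log_lim.eventually_gt_atTop 0, eventually_ge_atTop 1] with n hl hn
    have hn' : (0 : ℝ) < n := by exact_mod_cast hn
    rw [div_le_div_iff₀ (by positivity) hl, ← mul_assoc]
    gcongr
    calc _ ≤ ∑ i ∈ Finset.range N, (n : ℝ) ^ (-β) := by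
          gcongr with i hi
          have h1 : (1 + (i : ℝ))⁻¹ ≤ 1 := inv_le_one_of_one_le₀ (by simp)
          have h2 : (1 + (i : ℝ) + n) ^ (-β) ≤ (n : ℝ) ^ (-β) :=
            Real.rpow_le_rpow_of_nonpos hn' (by linarith [(by positivity : (0 : ℝ) ≤ i)]) (by linarith)
          calc _ ≤ 1 * (n : ℝ) ^ (-β) := by gcongr
            _ = _ := one_mul _
      _ = _ := by simp

lemma riemann_bounds {f : ℝ → ℝ} (hanti : AntitoneOn f (Ioi 0)) (hpos : ∀ x, 0 < x → 0 ≤ f x)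
    (hint : IntegrableOn f (Ioi 0)) {h : ℝ} (hh : 0 < h) :
    Summable (fun j : ℕ => h * f ((1 + j) * h)) ∧
    ∑' j : ℕ, h * f ((1 + j) * h) ≤ ∫ x in Ioi 0, f x ∧
    (∫ x in Ioi 0, f x) - ∫ x in (0 : ℝ)..h, f x ≤ ∑' j : ℕ, h * f ((1 + j) * h) := by
  have hii : ∀ a b : ℝ, 0 ≤ a → 0 ≤ b → IntervalIntegrable f volume a b := fun a b ha hb => by
    rw [intervalIntegrable_iff]
    refine hint.mono_set ?_
    intro x hx
    exact lt_of_le_of_lt (le_min ha hb) hx.1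
  have hnn : ∀ j : ℕ, 0 ≤ h * f ((1 + j) * h) := fun j => mul_nonneg hh.le (hpos _ (by positivity))
  have hup : ∀ J : ℕ, ∑ j ∈ Finset.range J, h * f ((1 + j) * h) ≤ ∫ x in Ioi 0, f x := by
    intro J
    have e := intervalIntegral.sum_integral_adjacent_intervals (f := f) (μ := volume)
      (a := fun k : ℕ => (k : ℝ) * h) (n := J)
      (fun k _ => hii _ _ (by positivity) (by positivity))
    calc _ ≤ ∑ k ∈ Finset.range J, ∫ x in ((k : ℝ) * h)..(((k + 1 : ℕ) : ℝ) * h), f x := by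
          gcongr with j hj
          have hjl : (j : ℝ) * h ≤ ((j + 1 : ℕ) : ℝ) * h := by push_cast; nlinarith
          have := intervalIntegral.integral_mono_on_of_le_Ioo (μ := volume)
            (f := fun _ => f ((1 + j) * h)) (g := f) hjl
            intervalIntegrable_const (hii _ _ (by positivity) (by positivity)) (by
              intro x hx
              have hx0 : 0 < x := lt_of_le_of_lt (by positivity) hx.1
              apply hanti hx0 (show (0 : ℝ) < (1 + j) * h by positivity)
              have := hx.2.le
              push_cast at this
              linarith)
          rw [intervalIntegral.integral_const] at this
          refine le_trans (le_of_eq ?_) this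
          push_cast
          simp only [smul_eq_mul]
          ring
      _ = ∫ x in ((0 : ℕ) : ℝ) * h..(J : ℝ) * h, f x := e
      _ = ∫ x in Ioc 0 ((J : ℝ) * h), f x := by
          rw [intervalIntegral.integral_of_le (by simp; positivity)]
          simp
      _ ≤ _ := by
          apply setIntegral_mono_set hint
          · filter_upwards [ae_restrict_mem measurableSet_Ioi] with x hx
            exact hpos x hx
          · exact (Ioc_subset_Ioi_self).eventuallyLE
  have hs : Summable (fun j : ℕ => h * f ((1 + j) * h)) :=
    summable_of_sum_range_le hnn hup
  refine ⟨hs, Real.tsum_le_of_sum_range_le hnn hup, ?_⟩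
  have hlow : ∀ J : ℕ, ∫ x in h..((1 + J : ℝ) * h), f x ≤ ∑' j : ℕ, h * f ((1 + j) * h) := by
    intro J
    have e := intervalIntegral.sum_integral_adjacent_intervals (f := f) (μ := volume)
      (a := fun k : ℕ => (1 + k : ℝ) * h) (n := J)
      (fun k _ => hii _ _ (by positivity) (by positivity))
    simp only [Nat.cast_zero, add_zero, one_mul] at e
    rw [← e]
    refine le_trans ?_ (hs.sum_le_tsum (Finset.range J) (fun j _ => hnn j))
    gcongr with j hj
    have hjl : (1 + j : ℝ) * h ≤ (1 + ((j + 1 : ℕ) : ℝ)) * h := by push_cast; nlinarith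
    have := intervalIntegral.integral_mono_on_of_le_Ioo (μ := volume)
      (g := fun _ => f ((1 + j) * h)) (f := f) hjl
      (hii _ _ (by positivity) (by positivity)) intervalIntegrable_const (by
        intro x hx
        have h0 : (0 : ℝ) < (1 + j) * h := by positivity
        exact hanti h0 (h0.trans hx.1) hx.1.le)
    rw [intervalIntegral.integral_const] at this
    refine le_trans this (le_of_eq ?_)
    push_cast
    simp only [smul_eq_mul]
    ring
  have hinth : IntegrableOn f (Ioi h) := hint.mono_set (Ioi_subset_Ioi hh.le)
  have hlim := intervalIntegral_tendsto_integral_Ioi (f := f) (μ := volume) h hinth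
    (b := fun J : ℕ => (1 + J : ℝ) * h) (l := atTop)
    ((tendsto_atTop_add_const_left _ 1 tendsto_natCast_atTop_atTop).atTop_mul_const hh)
  have hle := le_of_tendsto' hlim hlow
  have hsplit : ∫ x in Ioi 0, f x = (∫ x in (0 : ℝ)..h, f x) + ∫ x in Ioi h, f x := by
    rw [intervalIntegral.integral_of_le hh.le, ← setIntegral_union (Ioc_disjoint_Ioi le_rfl)
      measurableSet_Ioi (hint.mono_set Ioc_subset_Ioi_self) hinth, Ioc_union_Ioi_eq_Ioi hh.le]
  linarith

lemma riemann_tendsto {f : ℝ → ℝ} (hanti : AntitoneOn f (Ioi 0)) (hpos : ∀ x, 0 < x → 0 ≤ f x)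
    (hint : IntegrableOn f (Ioi 0)) :
    Tendsto (fun m : ℕ => ∑' j : ℕ, (1 / (m : ℝ)) * f ((1 + j) * (1 / (m : ℝ)))) atTop
      (nhds (∫ x in Ioi 0, f x)) := by
  have hI : IntegrableOn f (uIcc 0 1) := by
    rw [uIcc_of_le zero_le_one, integrableOn_Icc_iff_integrableOn_Ioc]
    exact hint.mono_set Ioc_subset_Ioi_self
  have hc := (intervalIntegral.continuousOn_primitive_interval hI) 0 (by simp)
  have h0 : Tendsto (fun m : ℕ => 1 / (m : ℝ)) atTop (nhdsWithin 0 (uIcc 0 1)) := by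
    rw [tendsto_nhdsWithin_iff]
    refine ⟨tendsto_one_div_atTop_nhds_zero_nat, ?_⟩
    filter_upwards [eventually_ge_atTop 1] with m hm
    have : (1 : ℝ) ≤ m := by exact_mod_cast hm
    rw [uIcc_of_le zero_le_one]
    exact ⟨by positivity, by rw [div_le_one (by linarith)]; exact this⟩
  have h1 := hc.tendsto.comp h0
  simp only [intervalIntegral.integral_same] at h1
  have h2 := h1.const_sub (∫ x in Ioi 0, f x)
  rw [sub_zero] at h2
  refine tendsto_of_tendsto_of_tendsto_of_le_of_le' h2 tendsto_const_nhds ?_ ?_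
  · filter_upwards [eventually_ge_atTop 1] with m hm
    have : (0 : ℝ) < m := by exact_mod_cast hm
    exact (riemann_bounds hanti hpos hint (h := 1 / (m : ℝ)) (by positivity)).2.2
  · filter_upwards [eventually_ge_atTop 1] with m hm
    have : (0 : ℝ) < m := by exact_mod_cast hm
    exact (riemann_bounds hanti hpos hint (h := 1 / (m : ℝ)) (by positivity)).2.1

lemma f_anti {p q : ℝ} (hp : 0 < p) (hq : 0 < q) :
    AntitoneOn (fun v : ℝ => v ^ (-p) * (1 + v) ^ (-q)) (Ioi 0) := by
  intro x hx y hy hxy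
  have hx : 0 < x := hx
  have hy : 0 < y := hy
  dsimp only
  have h1 := Real.rpow_le_rpow_of_nonpos hx hxy (by linarith : -p ≤ 0)
  have h2 := Real.rpow_le_rpow_of_nonpos (by linarith : 0 < 1 + x) (by linarith : 1 + x ≤ 1 + y)
    (by linarith : -q ≤ 0)
  gcongr

lemma f_int {p q : ℝ} (hp : 0 < p) (hp1 : p < 1) (hq : 0 < q) (hpq : 1 < p + q) :
    IntegrableOn (fun v : ℝ => v ^ (-p) * (1 + v) ^ (-q)) (Ioi 0) := by
  have hm : Measurable (fun v : ℝ => v ^ (-p) * (1 + v) ^ (-q)) := by fun_prop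
  rw [← Ioc_union_Ioi_eq_Ioi (zero_le_one (α := ℝ))]
  refine IntegrableOn.union ?_ ?_
  · have h1 : IntegrableOn (fun v : ℝ => v ^ (-p)) (Ioc 0 1) := by
      have := intervalIntegral.intervalIntegrable_rpow' (a := 0) (b := 1) (by linarith : -1 < -p)
      rwa [intervalIntegrable_iff_integrableOn_Ioc_of_le zero_le_one] at this
    refine Integrable.mono' h1 hm.aestronglyMeasurable ?_
    filter_upwards [ae_restrict_mem measurableSet_Ioc] with v hv
    have hv0 : 0 < v := hv.1
    rw [Real.norm_of_nonneg (by positivity)]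
    exact mul_le_of_le_one_right (by positivity)
      (Real.rpow_le_one_of_one_le_of_nonpos (by linarith) (by linarith))
  · have h1 : IntegrableOn (fun v : ℝ => v ^ (-(p + q))) (Ioi 1) :=
      integrableOn_Ioi_rpow_of_lt (by linarith) one_pos
    refine Integrable.mono' h1 hm.aestronglyMeasurable ?_
    filter_upwards [ae_restrict_mem measurableSet_Ioi] with v hv
    have hv0 : 0 < v := lt_trans one_pos hv
    rw [Real.norm_of_nonneg (by positivity), neg_add, Real.rpow_add hv0]
    have := Real.rpow_le_rpow_of_nonpos hv0 (by linarith : v ≤ 1 + v) (by linarith : -q ≤ 0)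
    gcongr

lemma b_eq {p q : ℝ} (m : ℕ) (hm : 1 ≤ m) (j : ℕ) :
    (1 + (j : ℝ)) ^ (-p) * (1 + j + m) ^ (-q) = (m : ℝ) ^ (1 - (p + q)) *
      ((1 / (m : ℝ)) * (((1 + j) * (1 / (m : ℝ))) ^ (-p) * (1 + (1 + j) * (1 / (m : ℝ))) ^ (-q))) := by
  have hm' : (0 : ℝ) < m := by exact_mod_cast hm
  have e : 1 + (1 + j) * (1 / (m : ℝ)) = (1 + j + m) * (1 / (m : ℝ)) := by field_simp; ring
  rw [e, Real.mul_rpow (by positivity) (by positivity), Real.mul_rpow (by positivity) (by positivity),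
    Real.rpow_neg (by positivity : 0 ≤ 1 / (m : ℝ)), Real.rpow_neg (by positivity : 0 ≤ 1 / (m : ℝ)),
    Real.div_rpow zero_le_one hm'.le, Real.div_rpow zero_le_one hm'.le, Real.rpow_sub hm',
    Real.rpow_add hm']
  simp only [Real.one_rpow, Real.rpow_one]
  field_simp

lemma b_summable {p q : ℝ} (hp : 0 < p) (hp1 : p < 1) (hq : 0 < q) (hpq : 1 < p + q)
    (m : ℕ) (hm : 1 ≤ m) :
    Summable (fun j : ℕ => (1 + (j : ℝ)) ^ (-p) * (1 + j + m) ^ (-q)) := by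
  have hm' : (0 : ℝ) < m := by exact_mod_cast hm
  simp_rw [b_eq m hm]
  exact ((riemann_bounds (f_anti hp hq) (fun x hx => by positivity) (f_int hp hp1 hq hpq)
    (h := 1 / (m : ℝ)) (by positivity)).1).mul_left _

lemma b_tendsto {p q : ℝ} (hp : 0 < p) (hp1 : p < 1) (hq : 0 < q) (hpq : 1 < p + q) :
    Tendsto (fun m : ℕ => (∑' j : ℕ, (1 + (j : ℝ)) ^ (-p) * (1 + j + m) ^ (-q)) /
      (m : ℝ) ^ (1 - (p + q))) atTop (nhds (∫ v in Ioi (0 : ℝ), v ^ (-p) * (1 + v) ^ (-q))) := by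
  refine (riemann_tendsto (f_anti hp hq) (fun x hx => by positivity)
    (f_int hp hp1 hq hpq)).congr' ?_
  filter_upwards [eventually_ge_atTop 1] with m hm
  have hm' : (0 : ℝ) < m := by exact_mod_cast hm
  simp_rw [b_eq m hm]
  rw [tsum_mul_left (a := (m : ℝ) ^ (1 - (p + q))), mul_div_cancel_left₀ _ (by positivity)]

lemma bN_tendsto {p q : ℝ} (hp : 0 < p) (hp1 : p < 1) (hq : 0 < q) (N : ℕ) :
    Tendsto (fun m : ℕ => (∑ j ∈ Finset.range N, (1 + (j : ℝ)) ^ (-p) * (1 + j + m) ^ (-q)) /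
      (m : ℝ) ^ (1 - (p + q))) atTop (nhds 0) := by
  have h0 : Tendsto (fun m : ℕ => (N : ℝ) * (m : ℝ) ^ (-(1 - p))) atTop (nhds 0) := by
    simpa using ((tendsto_rpow_neg_atTop (by linarith : 0 < 1 - p)).comp
      tendsto_natCast_atTop_atTop).const_mul (N : ℝ)
  refine tendsto_of_tendsto_of_tendsto_of_le_of_le' tendsto_const_nhds h0 ?_ ?_
  · filter_upwards with m
    exact div_nonneg (Finset.sum_nonneg fun i _ => by positivity) (by positivity)
  · filter_upwards [eventually_ge_atTop 1] with m hm
    have hm' : (0 : ℝ) < m := by exact_mod_cast hm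
    rw [div_le_iff₀ (by positivity), mul_assoc, ← Real.rpow_add hm',
      show -(1 - p) + (1 - (p + q)) = -q by ring]
    calc _ ≤ ∑ i ∈ Finset.range N, (m : ℝ) ^ (-q) := by
          gcongr with i hi
          have h1 : (1 + (i : ℝ)) ^ (-p) ≤ 1 :=
            Real.rpow_le_one_of_one_le_of_nonpos (by simp) (by linarith)
          have h2 : (1 + (i : ℝ) + m) ^ (-q) ≤ (m : ℝ) ^ (-q) :=
            Real.rpow_le_rpow_of_nonpos hm' (by linarith [(by positivity : (0 : ℝ) ≤ i)]) (by linarith)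
          calc _ ≤ 1 * (m : ℝ) ^ (-q) := by gcongr
            _ = _ := one_mul _
      _ = _ := by simp

lemma hasSum_prod' {a b : ℕ → ℝ} (ha : Summable a) (hb : Summable b) (ha0 : ∀ i, 0 ≤ a i)
    (hb0 : ∀ i, 0 ≤ b i) :
    HasSum (fun q : ℕ × ℕ => a q.1 * b q.2) ((∑' i, a i) * ∑' j, b j) := by
  have h := ha.mul_of_nonneg hb ha0 hb0
  rw [ha.tsum_mul_tsum hb h]
  exact h.hasSum

lemma error_sum {F : ℕ × ℕ → ℝ} {a b a' aN bN : ℕ → ℝ} {ε C D : ℝ}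
    (hF : Summable F) (ha : Summable a) (hb : Summable b) (ha' : Summable a')
    (haN : Summable aN) (hbN : Summable bN)
    (ha0 : ∀ i, 0 ≤ a i) (hb0 : ∀ i, 0 ≤ b i) (ha'0 : ∀ i, 0 ≤ a' i)
    (haN0 : ∀ i, 0 ≤ aN i) (hbN0 : ∀ i, 0 ≤ bN i)
    (h : ∀ q : ℕ × ℕ, |F q - a q.1 * b q.2| ≤ ε * (a q.1 * b q.2) + C * (aN q.1 * b q.2) +
      C * (a q.1 * bN q.2) + D * (a' q.1 * b q.2)) :
    |∑' q, F q - (∑' i, a i) * ∑' j, b j| ≤ ε * ((∑' i, a i) * ∑' j, b j) +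
      C * ((∑' i, aN i) * ∑' j, b j) + C * ((∑' i, a i) * ∑' j, bN j) +
      D * ((∑' i, a' i) * ∑' j, b j) := by
  have h1 := hasSum_prod' ha hb ha0 hb0
  have h2 := hasSum_prod' haN hb haN0 hb0
  have h3 := hasSum_prod' ha hbN ha0 hbN0
  have h4 := hasSum_prod' ha' hb ha'0 hb0
  have hR := (((h1.mul_left ε).add (h2.mul_left C)).add (h3.mul_left C)).add (h4.mul_left D)
  have hL := hF.hasSum.sub h1
  rw [← hL.tsum_eq, ← hR.tsum_eq, ← Real.norm_eq_abs]
  exact tsum_of_norm_bounded hR.summable.hasSum h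

lemma w_bdd {w : ℕ → ℕ → ℝ}
    (hA1 : Tendsto (fun p : ℕ × ℕ => w p.1 p.2) (atTop ×ˢ atTop) (nhds 1))
    {winf : ℕ → ℝ} (hA2 : ∀ i, Tendsto (fun j => w i j) atTop (nhds (winf i)))
    {wco : ℕ → ℝ} (hA3 : ∀ j, Tendsto (fun i => w i j) atTop (nhds (wco j))) :
    ∃ K, 0 ≤ K ∧ ∀ i j, |w i j| ≤ K := by
  have h1 := hA1.abs.eventually (gt_mem_nhds (show |(1 : ℝ)| < 2 by norm_num))
  rw [prod_atTop_atTop_eq, eventually_atTop] at h1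
  obtain ⟨⟨N1, N2⟩, hN⟩ := h1
  have hr : ∀ i, ∃ R, ∀ j, |w i j| ≤ R := fun i => by
    obtain ⟨R, hR⟩ := (hA2 i).abs.bddAbove_range
    exact ⟨R, fun j => hR ⟨j, rfl⟩⟩
  have hq : ∀ j, ∃ R, ∀ i, |w i j| ≤ R := fun j => by
    obtain ⟨R, hR⟩ := (hA3 j).abs.bddAbove_range
    exact ⟨R, fun i => hR ⟨i, rfl⟩⟩
  choose R hR using hr
  choose Q hQ using hq
  have hR0 : ∀ i, 0 ≤ R i := fun i => (abs_nonneg _).trans (hR i 0)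
  have hQ0 : ∀ i, 0 ≤ Q i := fun i => (abs_nonneg _).trans (hQ i 0)
  have s1 := Finset.sum_nonneg (s := Finset.range N1) (fun i _ => hR0 i)
  have s2 := Finset.sum_nonneg (s := Finset.range N2) (fun i _ => hQ0 i)
  refine ⟨2 + ∑ i ∈ Finset.range N1, R i + ∑ j ∈ Finset.range N2, Q j, by linarith, ?_⟩
  intro i j
  by_cases hi : i < N1
  · have := Finset.single_le_sum (s := Finset.range N1) (fun i _ => hR0 i) (Finset.mem_range.mpr hi)
    linarith [hR i j]
  by_cases hj : j < N2
  · have := Finset.single_le_sum (s := Finset.range N2) (fun i _ => hQ0 i) (Finset.mem_range.mpr hj)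
    linarith [hQ j i]
  have := hN (i, j) ⟨not_lt.mp hi, not_lt.mp hj⟩
  simp only at this
  linarith

lemma w_near {w : ℕ → ℕ → ℝ} {α : ℝ}
    (hA1 : Tendsto (fun p : ℕ × ℕ => w p.1 p.2) (atTop ×ˢ atTop) (nhds 1)) {ε : ℝ} (hε : 0 < ε) :
    ∃ N, ∀ i j i' j', N ≤ i → N ≤ j → N ≤ i' → N ≤ j' → 1 / 2 ≤ w i j ∧ 0 < w i' j' ∧
      w i' j' ≤ 2 ∧ |w i j ^ (α - 1) * w i' j' - 1| ≤ ε := by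
  have hc : Tendsto (fun z : ℝ × ℝ => |z.1 ^ (α - 1) * z.2 - 1|) (nhds 1 ×ˢ nhds 1) (nhds 0) := by
    have : ContinuousAt (fun z : ℝ × ℝ => |z.1 ^ (α - 1) * z.2 - 1|) (1, 1) := by
      have : ContinuousAt (fun z : ℝ × ℝ => z.1 ^ (α - 1)) (1, 1) :=
        continuousAt_fst.rpow_const (Or.inl one_ne_zero)
      exact ((this.mul continuousAt_snd).sub continuousAt_const).abs
    have h := this.tendsto
    rw [nhds_prod_eq] at h
    simpa using h
  have h1 := hc.eventually (gt_mem_nhds hε)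
  have h2 := hA1.eventually (lt_mem_nhds (show (1 / 2 : ℝ) < 1 by norm_num))
  have h3 := hA1.eventually (gt_mem_nhds (show (1 : ℝ) < 2 by norm_num))
  obtain ⟨S, hS, T, hT, hST⟩ := (Filter.eventually_prod_iff).mp h1
  have h4 := hA1.eventually hS
  have h5 := hA1.eventually hT
  have h6 := (h2.and h3).and (h4.and h5)
  rw [prod_atTop_atTop_eq, eventually_atTop] at h6
  obtain ⟨⟨N1, N2⟩, hN⟩ := h6
  refine ⟨max N1 N2, fun i j i' j' hi hj hi' hj' => ?_⟩
  have k1 := hN (i, j) ⟨(le_max_left _ _).trans hi, (le_max_right _ _).trans hj⟩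
  have k2 := hN (i', j') ⟨(le_max_left _ _).trans hi', (le_max_right _ _).trans hj'⟩
  simp only at k1 k2
  exact ⟨k1.1.1.le, by linarith [k2.1.1], k2.1.2.le, (hST k1.2.1 k2.2.2).le⟩

lemma tsum_ite_lt (a : ℕ → ℝ) (N : ℕ) :
    HasSum (fun i => if i < N then a i else 0) (∑ i ∈ Finset.range N, a i) := by
  have h : HasSum (fun i => if i < N then a i else 0)
      (∑ i ∈ Finset.range N, if i < N then a i else 0) :=
    hasSum_sum_of_ne_finset_zero (fun i hi => by simp at hi; simp [hi])
  convert h using 1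
  exact Finset.sum_congr rfl (fun i hi => by simp [Finset.mem_range.mp hi])

lemma Q_eq {α β₁ β₂ : ℝ} (hβ₁ : β₁ * (α - 1) = 1) (n m i j : ℕ) :
    ((1 + (i : ℝ)) ^ (-β₁) * (1 + (j : ℝ)) ^ (-β₂)) ^ (α - 1) *
      ((1 + (i : ℝ) + n) ^ (-β₁) * (1 + (j : ℝ) + m) ^ (-β₂)) =
    ((1 + (i : ℝ))⁻¹ * (1 + i + n) ^ (-β₁)) *
      ((1 + (j : ℝ)) ^ (-(β₂ * (α - 1))) * (1 + j + m) ^ (-β₂)) := by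
  rw [Real.mul_rpow (by positivity) (by positivity), ← Real.rpow_mul (by positivity),
    ← Real.rpow_mul (by positivity), neg_mul, neg_mul, hβ₁, Real.rpow_neg_one]
  ring

lemma ratio_le {β₁ β₂ : ℝ} (hβ₁ : 1 ≤ β₁) (hβ₂ : 0 < β₂) (n m i j : ℕ) :
    (((1 + (i : ℝ) + n) ^ (-β₁) * (1 + (j : ℝ) + m) ^ (-β₂)) /
      ((1 + (i : ℝ)) ^ (-β₁) * (1 + (j : ℝ)) ^ (-β₂))) ^ 2 ≤ (1 + (i : ℝ)) / (1 + i + n) := by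
  have hx0 : 0 < (1 + (i : ℝ)) / (1 + i + n) := by positivity
  have hx1 : (1 + (i : ℝ)) / (1 + i + n) ≤ 1 := by
    rw [div_le_one (by positivity)]
    linarith [(by positivity : (0 : ℝ) ≤ n)]
  have h1 : (1 + (i : ℝ) + n) ^ (-β₁) / (1 + (i : ℝ)) ^ (-β₁) ≤ (1 + (i : ℝ)) / (1 + i + n) := by
    have : (1 + (i : ℝ) + n) ^ (-β₁) / (1 + (i : ℝ)) ^ (-β₁) = ((1 + (i : ℝ)) / (1 + i + n)) ^ β₁ := by
      rw [Real.div_rpow (by positivity) (by positivity), Real.rpow_neg (by positivity),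
        Real.rpow_neg (by positivity)]
      field_simp
    rw [this]
    calc _ ≤ ((1 + (i : ℝ)) / (1 + i + n)) ^ (1 : ℝ) :=
          Real.rpow_le_rpow_of_exponent_ge hx0 hx1 hβ₁
      _ = _ := Real.rpow_one _
  have h2 : (1 + (j : ℝ) + m) ^ (-β₂) / (1 + (j : ℝ)) ^ (-β₂) ≤ 1 := by
    rw [div_le_one (by positivity)]
    exact Real.rpow_le_rpow_of_nonpos (by positivity) (by linarith [(by positivity : (0 : ℝ) ≤ m)])
      (by linarith)
  rw [mul_div_mul_comm]
  calc _ ≤ ((1 + (i : ℝ)) / (1 + i + n) * 1) ^ 2 := by gcongr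
    _ ≤ _ := by rw [mul_one]; nlinarith
theorem stmt3 (α β₁ β₂ : ℝ)
    (hα : 1 < α) (hα2 : α ≤ 2)
    (hβ₁ : β₁ = 1 / (α - 1)) (hβ₂l : 1 / α < β₂) (hβ₂u : β₂ < 1 / (α - 1))
    (w : ℕ → ℕ → ℝ) (hw : ∀ i j, w i j ≠ 0)
    (hA1 : Tendsto (fun p : ℕ × ℕ => w p.1 p.2) (atTop ×ˢ atTop) (nhds 1))
    (winf : ℕ → ℝ)
    (hA2 : ∀ i, Tendsto (fun j => w i j) atTop (nhds (winf i)) ∧ 0 < winf i)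
    (wco : ℕ → ℝ)
    (hA3 : ∀ j, Tendsto (fun i => w i j) atTop (nhds (wco j)) ∧ 0 < wco j)
    (c : ℕ → ℕ → ℝ)
    (hc : ∀ i j, c i j = w i j * (1 + (i : ℝ)) ^ (-β₁) * (1 + (j : ℝ)) ^ (-β₂))
    (ρ : ℕ → ℕ → ℝ)
    (hsum : ∀ n m : ℕ, 1 ≤ n → 1 ≤ m →
      Summable (fun q : ℕ × ℕ => V α (c q.1 q.2) (c (q.1 + n) (q.2 + m))))
    (hρ : ∀ n m : ℕ, 1 ≤ n → 1 ≤ m →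
      ρ n m = ∑' i : ℕ, ∑' j : ℕ, V α (c i j) (c (i + n) (j + m)))
    :
    Tendsto (fun p : ℕ × ℕ => ρ p.1 p.2 / ((p.1 : ℝ) ^ (-β₁) * (p.2 : ℝ) ^ (1 - β₂ * α) * Real.log p.1))
      (atTop ×ˢ atTop)
      (nhds (∫ v in Ioi (0 : ℝ), v ^ (-(β₂ * (α - 1))) * (1 + v) ^ (-β₂))) := by
  have hα1 : 0 < α - 1 := by linarith
  have hb1 : β₁ * (α - 1) = 1 := by rw [hβ₁]; field_simp
  have hβ1 : 1 ≤ β₁ := by rw [hβ₁, le_div_iff₀ hα1]; linarith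
  have hβ2 : 0 < β₂ := lt_trans (by positivity) hβ₂l
  set p := β₂ * (α - 1) with hp
  have hp0 : 0 < p := by positivity
  have hp1 : p < 1 := by rwa [lt_div_iff₀ hα1] at hβ₂u
  have hpq' : p + β₂ = β₂ * α := by rw [hp]; ring
  have hpq : 1 < p + β₂ := by
    rw [hpq']
    rwa [div_lt_iff₀ (by linarith)] at hβ₂l
  obtain ⟨K, hK0, hK⟩ := w_bdd hA1 (fun i => (hA2 i).1) (fun j => (hA3 j).1)
  set L := ∫ v in Ioi (0 : ℝ), v ^ (-p) * (1 + v) ^ (-β₂) with hL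
  rw [← hpq']
  -- the one-dimensional sums
  set A : ℕ → ℝ := fun n => ∑' i : ℕ, (1 + (i : ℝ))⁻¹ * (1 + i + n) ^ (-β₁) with hAdef
  set A' : ℕ → ℝ := fun n => ∑' i : ℕ, (1 + (i : ℝ))⁻¹ * (1 + i + n) ^ (-β₁) *
    ((1 + i) / (1 + i + n)) with hA'def
  set B : ℕ → ℝ := fun m => ∑' j : ℕ, (1 + (j : ℝ)) ^ (-p) * (1 + j + m) ^ (-β₂) with hBdef
  set D : ℕ → ℝ := fun n => (n : ℝ) ^ (-β₁) * Real.log n with hD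
  set E : ℕ → ℝ := fun m => (m : ℝ) ^ (1 - (p + β₂)) with hE
  have tA : Tendsto (fun q : ℕ × ℕ => A q.1 / D q.1) (atTop ×ˢ atTop) (nhds 1) :=
    (a_tendsto hβ1).comp tendsto_fst
  have tA' : Tendsto (fun q : ℕ × ℕ => A' q.1 / D q.1) (atTop ×ˢ atTop) (nhds 0) :=
    (a'_tendsto hβ1).comp tendsto_fst
  have tB : Tendsto (fun q : ℕ × ℕ => B q.2 / E q.2) (atTop ×ˢ atTop) (nhds L) :=
    (b_tendsto hp0 hp1 hβ2 hpq).comp tendsto_snd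
  have tAB := tA.mul tB
  rw [one_mul] at tAB
  have hL0 : 0 ≤ L := setIntegral_nonneg measurableSet_Ioi fun v hv => by
    have : 0 < v := hv
    positivity
  set C := K ^ (α - 1) * K + 1 with hC
  have hC0 : 0 ≤ C := by positivity
  have hev : ∀ᶠ q : ℕ × ℕ in atTop ×ˢ atTop, 2 ≤ q.1 ∧ 1 ≤ q.2 :=
    (eventually_ge_atTop 2).prod_mk (eventually_ge_atTop 1)
  have main : Tendsto (fun q : ℕ × ℕ => ρ q.1 q.2 / (D q.1 * E q.2) -
      A q.1 / D q.1 * (B q.2 / E q.2)) (atTop ×ˢ atTop) (nhds 0) := by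
    rw [Metric.tendsto_nhds]
    intro η hη
    set ε := min 1 (η / (2 * (L + 1))) with hε
    have hε0 : 0 < ε := by positivity
    have hε1 : ε ≤ 1 := min_le_left _ _
    have hεη : ε * L < η := by
      have h1 : ε ≤ η / (2 * (L + 1)) := min_le_right _ _
      rw [le_div_iff₀ (by positivity)] at h1
      nlinarith
    obtain ⟨N, hN⟩ := w_near (α := α) hA1 hε0
    set AN : ℕ → ℝ := fun n => ∑ i ∈ Finset.range N, (1 + (i : ℝ))⁻¹ * (1 + i + n) ^ (-β₁)
      with hAN
    set BN : ℕ → ℝ := fun m => ∑ j ∈ Finset.range N, (1 + (j : ℝ)) ^ (-p) * (1 + j + m) ^ (-β₂)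
      with hBN
    have tAN : Tendsto (fun q : ℕ × ℕ => AN q.1 / D q.1) (atTop ×ˢ atTop) (nhds 0) :=
      (aN_tendsto hβ1 N).comp tendsto_fst
    have tBN : Tendsto (fun q : ℕ × ℕ => BN q.2 / E q.2) (atTop ×ˢ atTop) (nhds 0) :=
      (bN_tendsto hp0 hp1 hβ2 N).comp tendsto_snd
    have tR := (((tAB.const_mul ε).add ((tAN.mul tB).const_mul C)).add
      ((tA.mul tBN).const_mul C)).add ((tA'.mul tB).const_mul 32)
    have tR2 := tR.eventually (gt_mem_nhds (show ε * L + C * (0 * L) + C * (1 * 0) + 32 * (0 * L) < η by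
      simpa using hεη))
    filter_upwards [tR2, hev] with ⟨n, m⟩ hR ⟨hn2, hm⟩
    simp only at hR hn2 hm ⊢
    have hn : 1 ≤ n := by omega
    have hn' : (0 : ℝ) < n := by exact_mod_cast hn
    have hm' : (0 : ℝ) < m := by exact_mod_cast hm
    have hD0 : 0 < D n := mul_pos (by positivity) (Real.log_pos (by exact_mod_cast hn2))
    have hE0 : 0 < E m := by simp only [hE]; positivity
    have hcn : ∀ i j : ℕ, c (i + n) (j + m) = w (i + n) (j + m) *
        ((1 + (i : ℝ) + n) ^ (-β₁) * (1 + (j : ℝ) + m) ^ (-β₂)) := by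
      intro i j
      rw [hc]
      push_cast
      rw [add_assoc 1 (i : ℝ), add_assoc 1 (j : ℝ)]
      ring
    have herr := error_sum (ε := ε) (C := C) (D := 32)
      (a := fun i : ℕ => (1 + (i : ℝ))⁻¹ * (1 + i + n) ^ (-β₁))
      (b := fun j : ℕ => (1 + (j : ℝ)) ^ (-p) * (1 + j + m) ^ (-β₂))
      (a' := fun i : ℕ => (1 + (i : ℝ))⁻¹ * (1 + i + n) ^ (-β₁) * ((1 + i) / (1 + i + n)))
      (aN := fun i : ℕ => if i < N then (1 + (i : ℝ))⁻¹ * (1 + i + n) ^ (-β₁) else 0)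
      (bN := fun j : ℕ => if j < N then (1 + (j : ℝ)) ^ (-p) * (1 + j + m) ^ (-β₂) else 0)
      (hsum n m hn hm) (a_summable hβ1 n hn) (b_summable hp0 hp1 hβ2 hpq m hm)
      (a'_bound hβ1 n hn).1 (tsum_ite_lt _ N).summable (tsum_ite_lt _ N).summable
      (fun i => by positivity) (fun i => by positivity) (fun i => by positivity)
      (fun i => by positivity) (fun i => by positivity) (by
        rintro ⟨i, j⟩
        simp only
        rw [hcn, hc, mul_assoc (w i j), hp, ← mul_assoc ε]
        have hQ := Q_eq (β₂ := β₂) hb1 n m i j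
        have hr := ratio_le hβ1 hβ2 n m i j
        have hx : 0 < (1 + (i : ℝ)) ^ (-β₁) * (1 + (j : ℝ)) ^ (-β₂) := by positivity
        have hy : 0 < (1 + (i : ℝ) + n) ^ (-β₁) * (1 + (j : ℝ) + m) ^ (-β₂) := by positivity
        have hcr := V_crude hα hα2 hK0 (hw i j) (hK i j) (hK (i + n) (j + m)) hx hy
        rw [hQ, ← hC] at hcr
        have ha0 : 0 < (1 + (i : ℝ))⁻¹ * (1 + i + n) ^ (-β₁) := by positivity
        have hb0 : 0 < (1 + (j : ℝ)) ^ (-(β₂ * (α - 1))) * (1 + (j : ℝ) + m) ^ (-β₂) := by positivity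
        have ht0 : 0 < (1 + (i : ℝ)) / (1 + i + n) := by positivity
        by_cases hi : i < N
        · rw [if_pos hi]
          refine hcr.trans ?_
          have e : 0 ≤ (if j < N then (1 + (j : ℝ)) ^ (-(β₂ * (α - 1))) * (1 + (j : ℝ) + m) ^ (-β₂) else 0) := by
            positivity
          have e1 := mul_nonneg hC0 (mul_nonneg ha0.le e)
          have e2 := mul_pos (mul_pos ha0 ht0) hb0
          have e3 := mul_pos hε0 (mul_pos ha0 hb0)
          linarith
        by_cases hj : j < N
        · rw [if_pos hj, if_neg hi]
          refine hcr.trans ?_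
          have e2 := mul_pos (mul_pos ha0 ht0) hb0
          have e3 := mul_pos hε0 (mul_pos ha0 hb0)
          linarith
        rw [if_neg hi, if_neg hj]
        obtain ⟨w1, w2, w3, w4⟩ := hN i j (i + n) (j + m) (by omega) (by omega) (by omega) (by omega)
        have hf := V_fine hα hα2 hε1 w1 w2 w3 w4 hx hy
        rw [hQ] at hf
        refine hf.trans ?_
        have := mul_le_mul_of_nonneg_right hr (mul_pos ha0 hb0).le
        linarith)
    rw [(tsum_ite_lt _ N).tsum_eq, (tsum_ite_lt _ N).tsum_eq, (hsum n m hn hm).tsum_prod,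
      ← hρ n m hn hm] at herr
    change |ρ n m - A n * B m| ≤ ε * (A n * B m) + C * (AN n * B m) + C * (A n * BN m) +
      32 * (A' n * B m) at herr
    rw [dist_zero_right, Real.norm_eq_abs, div_mul_div_comm, ← sub_div, abs_div,
      abs_of_pos (mul_pos hD0 hE0)]
    refine lt_of_le_of_lt ?_ hR
    rw [div_le_iff₀ (mul_pos hD0 hE0)]
    refine herr.trans (le_of_eq ?_)
    field_simp
  have := main.add tAB
  rw [zero_add] at this
  refine this.congr (fun q => ?_)
  simp only [hD, hE]
  rw [sub_add_cancel]
  congr 1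
  ring
end

section
/- Let 1 < α ≤ 2, β₁ = 1/(α−1) and β₂ > 1/(α−1). Then the doubly-indexed limit, as n → ∞ and m → ∞ (along the product filter), of ρ(n,m)/(n^{−β₁} m^{−β₂} ln n) exists and equals Σ_{j=0}^∞ w_{(∞,j)}^{α−1} (1+j)^{−β₂(α−1)}. -/
open Filter MeasureTheory Real Set

open Topology

lemma aux_toeplitz {F : Filter (ℕ × ℕ)} (A b : ℕ → ℕ × ℕ → ℝ) (C L : ℝ)
    (hA : ∀ᶠ p in F, (∀ i, 0 ≤ A i p) ∧ Summable (fun i => A i p))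
    (hA0 : ∀ i, Tendsto (A i) F (𝓝 0))
    (hA1 : Tendsto (fun p => ∑' i, A i p) F (𝓝 1))
    (hb : ∀ i p, |b i p| ≤ C)
    (hbL : Tendsto (fun q : ℕ × (ℕ × ℕ) => b q.1 q.2) (atTop ×ˢ F) (𝓝 L)) :
    Tendsto (fun p => ∑' i, A i p * b i p) F (𝓝 L) := by
  have key : Tendsto (fun p => ∑' i, A i p * (b i p - L)) F (𝓝 0) := by
    rw [Metric.tendsto_nhds]
    intro ε hε
    have h1 := (Metric.tendsto_nhds.1 hbL) (ε / 4) (by positivity)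
    obtain ⟨P, hP, Q, hQ, hPQ⟩ := Filter.eventually_prod_iff.1 h1
    obtain ⟨I, hI⟩ := Filter.eventually_atTop.1 hP
    have h2 : Tendsto (fun p => ∑ i ∈ Finset.range I, A i p * (C + |L|)) F (𝓝 0) := by
      have := tendsto_finsetSum (Finset.range I)
        (fun i _ => (hA0 i).mul_const (C + |L|))
      simpa using this
    have h3 := (Metric.tendsto_nhds.1 h2) (ε / 4) (by positivity)
    have h4 := hA1.eventually (gt_mem_nhds (show (1:ℝ) < 2 by norm_num))
    filter_upwards [hA, hQ, h3, h4] with p hAp hQp h3p h4p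
    obtain ⟨hn, hs⟩ := hAp
    have hd : ∀ i, |b i p - L| ≤ C + |L| := fun i =>
      (abs_sub _ _).trans (by linarith [hb i p])
    have hs1 : Summable (fun i => if i ∈ Finset.range I then A i p * (C + |L|) else 0) :=
      summable_of_ne_finset_zero (s := Finset.range I) (fun i hi => by simp only [hi, if_false])
    have hs2 : Summable (fun i => (if i ∈ Finset.range I then A i p * (C + |L|) else 0)
        + ε / 4 * A i p) := hs1.add (hs.mul_left _)
    have hle : ∀ i, ‖A i p * (b i p - L)‖ ≤
        (if i ∈ Finset.range I then A i p * (C + |L|) else 0) + ε / 4 * A i p := by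
      intro i
      rw [Real.norm_eq_abs, abs_mul, abs_of_nonneg (hn i)]
      have h0 := hn i
      split_ifs with hi
      · have := mul_le_mul_of_nonneg_left (hd i) h0
        have : 0 ≤ ε / 4 * A i p := by positivity
        linarith
      · have hiI : I ≤ i := by simpa using hi
        have := hPQ (hI i hiI) hQp
        rw [Real.dist_eq] at this
        nlinarith
    have hb1 := tsum_of_norm_bounded hs2.hasSum hle
    rw [hs1.tsum_add (hs.mul_left _), tsum_mul_left] at hb1
    have e1 : ∑' i, (if i ∈ Finset.range I then A i p * (C + |L|) else 0)
        = ∑ i ∈ Finset.range I, A i p * (C + |L|) := by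
      rw [tsum_eq_sum (s := Finset.range I) (fun i hi => by simp only [hi, if_false])]
      exact Finset.sum_congr rfl (fun i hi => by simp only [hi, if_true])
    rw [e1] at hb1
    rw [Real.dist_eq, sub_zero] at h3p ⊢
    rw [Real.norm_eq_abs] at hb1
    have := le_abs_self (∑ i ∈ Finset.range I, A i p * (C + |L|))
    nlinarith
  have h5 := key.add (hA1.mul_const L)
  rw [zero_add, one_mul] at h5
  refine h5.congr' ?_
  filter_upwards [hA] with p hAp
  obtain ⟨hn, hs⟩ := hAp
  have hsb : Summable (fun i => A i p * (b i p - L)) := by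
    refine Summable.of_norm_bounded (hs.mul_right (C + |L|)) (fun i => ?_)
    rw [Real.norm_eq_abs, abs_mul, abs_of_nonneg (hn i)]
    exact mul_le_mul_of_nonneg_left ((abs_sub _ _).trans (by linarith [hb i p])) (hn i)
  rw [← tsum_mul_right, ← hsb.tsum_add (hs.mul_right L)]
  exact tsum_congr (fun i => by ring)

lemma aux_bdd_s4 (u : ℕ → ℕ → ℝ) (l : ℝ) (r s : ℕ → ℝ)
    (h1 : Tendsto (fun p : ℕ × ℕ => u p.1 p.2) (atTop ×ˢ atTop) (𝓝 l))
    (h2 : ∀ i, Tendsto (fun j => u i j) atTop (𝓝 (r i)))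
    (h3 : ∀ j, Tendsto (fun i => u i j) atTop (𝓝 (s j))) :
    ∃ M, 0 < M ∧ ∀ i j, |u i j| ≤ M := by
  have hbd : ∀ (f : ℕ → ℝ) (x : ℝ), Tendsto f atTop (𝓝 x) → ∃ K, 0 ≤ K ∧ ∀ n, |f n| ≤ K := by
    intro f x hf
    obtain ⟨K, hK⟩ := hf.abs.bddAbove_range
    exact ⟨K, (abs_nonneg (f 0)).trans (hK ⟨0, rfl⟩), fun n => hK ⟨n, rfl⟩⟩
  choose R hR0 hR using fun i => hbd _ _ (h2 i)
  choose S hS0 hS using fun j => hbd _ _ (h3 j)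
  have h4 := h1.abs.eventually (gt_mem_nhds (show |l| < |l| + 1 by linarith))
  rw [Filter.prod_atTop_atTop_eq] at h4
  obtain ⟨⟨N1, N2⟩, hN⟩ := Filter.eventually_atTop.1 h4
  have p1 : 0 ≤ ∑ i ∈ Finset.range N1, R i := Finset.sum_nonneg (fun i _ => hR0 i)
  have p2 : 0 ≤ ∑ i ∈ Finset.range N2, S i := Finset.sum_nonneg (fun i _ => hS0 i)
  have p3 := abs_nonneg l
  refine ⟨|l| + 1 + ∑ i ∈ Finset.range N1, R i + ∑ i ∈ Finset.range N2, S i, by linarith, ?_⟩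
  intro i j
  by_cases hi : i < N1
  · have := Finset.single_le_sum (f := R) (fun i _ => hR0 i) (Finset.mem_range.2 hi)
    linarith [hR i j]
  by_cases hj : j < N2
  · have := Finset.single_le_sum (f := S) (fun i _ => hS0 i) (Finset.mem_range.2 hj)
    linarith [hS j i]
  have := hN (i, j) ⟨not_lt.1 hi, not_lt.1 hj⟩
  simp only at this
  linarith

noncomputable def auxA (β : ℝ) (i n : ℕ) : ℝ :=
  (1 + (i : ℝ))⁻¹ * ((n : ℝ) / (1 + i + n)) ^ β

lemma auxA_nonneg (β : ℝ) (i n : ℕ) : 0 ≤ auxA β i n := by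
  unfold auxA; positivity

lemma auxA_le (β : ℝ) (hβ : 1 ≤ β) (i n : ℕ) :
    auxA β i n ≤ 1 / (1 + (i:ℝ)) - 1 / (1 + i + n) := by
  unfold auxA
  have h1 : (n : ℝ) / (1 + i + n) ≤ 1 := by
    rw [div_le_one (by positivity)]; have : (0:ℝ) ≤ i := by positivity
    linarith
  have h2 := Real.rpow_le_self_of_le_one (show 0 ≤ (n : ℝ) / (1 + i + n) by positivity) h1 hβ
  calc _ ≤ (1 + (i : ℝ))⁻¹ * ((n : ℝ) / (1 + i + n)) := by gcongr
    _ = _ := by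
      have : (1 + (i:ℝ)) ≠ 0 := by positivity
      have : (1 + (i:ℝ) + n) ≠ 0 := by positivity
      field_simp
      ring

lemma auxA_partial (β : ℝ) (hβ : 1 ≤ β) (n N : ℕ) :
    ∑ i ∈ Finset.range N, auxA β i n ≤ ∑ i ∈ Finset.range n, 1 / (1 + (i:ℝ)) := by
  calc _ ≤ ∑ i ∈ Finset.range N, (1 / (1 + (i:ℝ)) - 1 / (1 + i + n)) :=
        Finset.sum_le_sum (fun i _ => auxA_le β hβ i n)
    _ ≤ _ := by
      rw [Finset.sum_sub_distrib]
      have h1 := Finset.sum_range_add (fun i : ℕ => 1 / (1 + (i:ℝ))) n N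
      have h2 := Finset.sum_range_add (fun i : ℕ => 1 / (1 + (i:ℝ))) N n
      rw [add_comm N n] at h2
      have h3 : 0 ≤ ∑ i ∈ Finset.range n, 1 / (1 + ((N + i : ℕ):ℝ)) :=
        Finset.sum_nonneg (fun i _ => by positivity)
      have h4 : ∑ i ∈ Finset.range N, 1 / (1 + ((n + i : ℕ):ℝ))
          = ∑ i ∈ Finset.range N, 1 / (1 + (i:ℝ) + n) :=
        Finset.sum_congr rfl (fun i _ => by push_cast; ring_nf)
      linarith

lemma auxA_summable (β : ℝ) (hβ : 1 ≤ β) (n : ℕ) : Summable (fun i => auxA β i n) :=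
  summable_of_sum_range_le (fun i => auxA_nonneg β i n) (fun N => auxA_partial β hβ n N)

lemma auxA_lower (β : ℝ) (hβ : 1 ≤ β) (n : ℕ) (hn : 1 ≤ n) :
    (∑ i ∈ Finset.range n, 1 / (1 + (i:ℝ))) - β ≤ ∑' i, auxA β i n := by
  have hn0 : (0:ℝ) < n := by exact_mod_cast hn
  have h1 : ∀ i : ℕ, 1 / (1 + (i:ℝ)) - β / n ≤ auxA β i n := by
    intro i
    unfold auxA
    have hp : (0:ℝ) < 1 + i := by positivity
    have hx : (0:ℝ) < n / (1 + i + n) := by positivity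
    have h2 : 1 - β * ((1 + i) / n) ≤ ((n : ℝ) / (1 + i + n)) ^ β := by
      rw [Real.rpow_def_of_pos hx]
      have h3 := Real.add_one_le_exp (Real.log ((n : ℝ) / (1 + i + n)) * β)
      have h4 := Real.one_sub_inv_le_log_of_pos hx
      have h5 : 1 - ((n : ℝ) / (1 + i + n))⁻¹ = - ((1 + i) / n) := by
        field_simp; ring
      rw [h5] at h4
      nlinarith
    calc _ = (1 + (i:ℝ))⁻¹ * (1 - β * ((1 + i) / n)) := by field_simp
      _ ≤ _ := by gcongr
  calc _ = ∑ i ∈ Finset.range n, (1 / (1 + (i:ℝ)) - β / n) := by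
        rw [Finset.sum_sub_distrib]; simp; field_simp
    _ ≤ ∑ i ∈ Finset.range n, auxA β i n := Finset.sum_le_sum (fun i _ => h1 i)
    _ ≤ _ := (auxA_summable β hβ n).sum_le_tsum _ (fun i _ => auxA_nonneg β i n)

lemma auxA_tendsto (β : ℝ) (hβ : 1 ≤ β) :
    Tendsto (fun n : ℕ => (∑' i, auxA β i n) / Real.log n) atTop (𝓝 1) := by
  have hlog : Tendsto (fun n : ℕ => Real.log n) atTop atTop :=
    Real.tendsto_log_atTop.comp tendsto_natCast_atTop_atTop
  have hH : ∀ n : ℕ, ∑ i ∈ Finset.range n, 1 / (1 + (i:ℝ)) = (harmonic n : ℝ) := by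
    intro n
    simp [harmonic, add_comm]
  have hz : ∀ k : ℝ, Tendsto (fun n : ℕ => k / Real.log n) atTop (𝓝 0) := fun k =>
    hlog.const_div_atTop k
  have hlo : Tendsto (fun n : ℕ => 1 + (-β) / Real.log n) atTop (𝓝 1) := by
    simpa using (hz (-β)).const_add 1
  have hhi : Tendsto (fun n : ℕ => 1 + 1 / Real.log n) atTop (𝓝 1) := by
    simpa using (hz 1).const_add 1
  have hpos : ∀ᶠ n : ℕ in atTop, 0 < Real.log n := hlog.eventually_gt_atTop 0
  refine tendsto_of_tendsto_of_tendsto_of_le_of_le' hlo hhi ?_ ?_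
  · filter_upwards [hpos, eventually_ge_atTop 1] with n hn h1
    have h := auxA_lower β hβ n h1
    rw [hH] at h
    have h2 := log_add_one_le_harmonic n
    have h3 : Real.log n ≤ Real.log (↑(n+1)) := by
      apply Real.log_le_log
      · exact_mod_cast h1
      · push_cast; linarith
    rw [le_div_iff₀ hn]
    have : (1 + -β / Real.log n) * Real.log n = Real.log n - β := by field_simp; ring
    rw [this]; linarith
  · filter_upwards [hpos, eventually_ge_atTop 1] with n hn h1
    have h : ∑' i, auxA β i n ≤ ∑ i ∈ Finset.range n, 1 / (1 + (i:ℝ)) :=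
      Real.tsum_le_of_sum_range_le (fun i => auxA_nonneg β i n) (fun N => auxA_partial β hβ n N)
    rw [hH] at h
    have h2 := harmonic_le_one_add_log n
    rw [div_le_iff₀ hn]
    have : (1 + 1 / Real.log n) * Real.log n = Real.log n + 1 := by field_simp
    rw [this]; linarith

noncomputable def auxB (α β₂ : ℝ) (w c : ℕ → ℕ → ℝ) (j i : ℕ) (p : ℕ × ℕ) : ℝ :=
  w (i + p.1) (j + p.2) * ((p.2 : ℝ) / (1 + j + p.2)) ^ β₂ * (w i j * |w i j| ^ (α - 2)) *
    (1 + (j:ℝ)) ^ (-(β₂ * (α - 1))) * (1 + (c (i + p.1) (j + p.2) / c i j) ^ 2) ^ (-((2 - α) / 2))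

lemma aux_V_s4 (α x y : ℝ) (hx : x ≠ 0) :
    V α x y = y * (x * |x| ^ (α - 2)) * (1 + (y / x) ^ 2) ^ (-((2 - α) / 2)) := by
  unfold V
  rw [if_neg (fun h => hx h.1)]
  have e : x ^ 2 + y ^ 2 = |x| ^ (2:ℝ) * (1 + (y / x) ^ 2) := by
    rw [Real.rpow_two, sq_abs]; field_simp
  rw [e, div_eq_mul_inv, ← Real.rpow_neg (by positivity), Real.mul_rpow (by positivity) (by positivity),
    ← Real.rpow_mul (abs_nonneg x)]
  rw [show 2 * -((2 - α) / 2) = α - 2 by ring]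
  ring

lemma aux_sgnpow (α x r : ℝ) (hr : 0 < r) :
    (x * r) * |x * r| ^ (α - 2) = (x * |x| ^ (α - 2)) * r ^ (α - 1) := by
  rw [abs_mul, abs_of_pos hr, Real.mul_rpow (abs_nonneg _) hr.le,
    show α - 1 = (α - 2) + 1 by ring, Real.rpow_add_one hr.ne']
  ring

theorem stmt4 (α β₁ β₂ : ℝ)
    (hα : 1 < α) (hα2 : α ≤ 2)
    (hβ₁ : β₁ = 1 / (α - 1)) (hβ₂ : 1 / (α - 1) < β₂)
    (w : ℕ → ℕ → ℝ) (hw : ∀ i j, w i j ≠ 0)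
    (hA1 : Tendsto (fun p : ℕ × ℕ => w p.1 p.2) (atTop ×ˢ atTop) (nhds 1))
    (winf : ℕ → ℝ)
    (hA2 : ∀ i, Tendsto (fun j => w i j) atTop (nhds (winf i)) ∧ 0 < winf i)
    (wco : ℕ → ℝ)
    (hA3 : ∀ j, Tendsto (fun i => w i j) atTop (nhds (wco j)) ∧ 0 < wco j)
    (c : ℕ → ℕ → ℝ)
    (hc : ∀ i j, c i j = w i j * (1 + (i : ℝ)) ^ (-β₁) * (1 + (j : ℝ)) ^ (-β₂))
    (ρ : ℕ → ℕ → ℝ)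
    (hsum : ∀ n m : ℕ, 1 ≤ n → 1 ≤ m →
      Summable (fun q : ℕ × ℕ => V α (c q.1 q.2) (c (q.1 + n) (q.2 + m))))
    (hρ : ∀ n m : ℕ, 1 ≤ n → 1 ≤ m →
      ρ n m = ∑' i : ℕ, ∑' j : ℕ, V α (c i j) (c (i + n) (j + m)))
    :
    Tendsto (fun p : ℕ × ℕ => ρ p.1 p.2 / ((p.1 : ℝ) ^ (-β₁) * (p.2 : ℝ) ^ (-β₂) * Real.log p.1))
      (atTop ×ˢ atTop)
      (nhds (∑' j : ℕ, wco j ^ (α - 1) * (1 + (j : ℝ)) ^ (-(β₂ * (α - 1))))) := by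
  have hγ : 0 < α - 1 := by linarith
  have hβγ : β₁ * (α - 1) = 1 := by rw [hβ₁]; field_simp
  have hβ1 : 1 ≤ β₁ := by
    rw [hβ₁, le_div_iff₀ hγ]; linarith
  have hβ2pos : 0 < β₂ := lt_trans (by positivity) hβ₂
  have hβ2γ : 1 < β₂ * (α - 1) := by
    rwa [div_lt_iff₀ hγ] at hβ₂
  obtain ⟨M, hM0, hM⟩ := aux_bdd_s4 w 1 winf wco hA1 (fun i => (hA2 i).1) (fun i => (hA3 i).1)
  obtain ⟨D, hD0, hD⟩ := aux_bdd_s4 (fun i j => (w i j)⁻¹) (1⁻¹) (fun i => (winf i)⁻¹)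
    (fun i => (wco i)⁻¹) (hA1.inv₀ one_ne_zero) (fun i => (hA2 i).1.inv₀ (hA2 i).2.ne')
    (fun i => (hA3 i).1.inv₀ (hA3 i).2.ne')
  have hc0 : ∀ i j, c i j ≠ 0 := by
    intro i j
    rw [hc]
    have : (0:ℝ) < (1 + (i : ℝ)) ^ (-β₁) := by positivity
    have : (0:ℝ) < (1 + (j : ℝ)) ^ (-β₂) := by positivity
    have := hw i j
    positivity
  -- the key identity
  have hV : ∀ i j n m : ℕ, 1 ≤ n → 1 ≤ m →
      V α (c i j) (c (i + n) (j + m)) / ((n : ℝ) ^ (-β₁) * (m : ℝ) ^ (-β₂) * Real.log n)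
        = auxA β₁ i n / Real.log n * auxB α β₂ w c j i (n, m) := by
    intro i j n m hn hm
    have hn0 : (0:ℝ) < n := by exact_mod_cast hn
    have hm0 : (0:ℝ) < m := by exact_mod_cast hm
    have hi0 : (0:ℝ) < 1 + i := by positivity
    have hj0 : (0:ℝ) < 1 + j := by positivity
    rw [aux_V_s4 α _ _ (hc0 i j)]
    unfold auxA auxB
    simp only
    generalize (1 + (c (i + n) (j + m) / c i j) ^ 2) ^ (-((2 - α) / 2)) = T
    rw [hc i j, hc (i + n) (j + m), mul_assoc (w i j), aux_sgnpow α _ _ (by positivity),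
      Real.mul_rpow (by positivity) (by positivity), ← Real.rpow_mul hi0.le,
      ← Real.rpow_mul hj0.le, neg_mul, hβγ, Real.rpow_neg_one, neg_mul,
      Real.div_rpow hn0.le (by positivity), Real.div_rpow hm0.le (by positivity),
      Real.rpow_neg hn0.le, Real.rpow_neg hm0.le, Real.rpow_neg (by positivity),
      Real.rpow_neg (by positivity)]
    push_cast
    rw [← add_assoc, ← add_assoc]
    generalize w i j * |w i j| ^ (α - 2) = U
    have : (0:ℝ) < (n:ℝ) ^ β₁ := by positivity
    have : (0:ℝ) < (m:ℝ) ^ β₂ := by positivity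
    have : (0:ℝ) < (1 + (i:ℝ) + n) ^ β₁ := by positivity
    have : (0:ℝ) < (1 + (j:ℝ) + m) ^ β₂ := by positivity
    generalize (1 + (j:ℝ)) ^ (-(β₂ * (α - 1))) = Z
    field_simp
  -- bound on B
  have hB : ∀ j i p, |auxB α β₂ w c j i p| ≤ M * M ^ (α - 1) * (1 + (j:ℝ)) ^ (-(β₂ * (α - 1))) := by
    intro j i p
    unfold auxB
    have hj0 : (0:ℝ) < 1 + j := by positivity
    have e1 : |w i j * |w i j| ^ (α - 2)| ≤ M ^ (α - 1) := by
      have hp : 0 < |w i j| := abs_pos.2 (hw i j)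
      rw [abs_mul, abs_of_pos (Real.rpow_pos_of_pos hp _)]
      calc |w i j| * |w i j| ^ (α - 2) = |w i j| ^ (α - 1) := by
            rw [show α - 1 = (α - 2) + 1 by ring, Real.rpow_add_one hp.ne']; ring
        _ ≤ _ := Real.rpow_le_rpow hp.le (hM i j) hγ.le
    have e2 : |((p.2 : ℝ) / (1 + j + p.2)) ^ β₂| ≤ 1 := by
      rw [abs_of_nonneg (by positivity)]
      apply Real.rpow_le_one (by positivity) _ hβ2pos.le
      rw [div_le_one (by positivity)]; linarith
    have e3 : |(1 + (c (i + p.1) (j + p.2) / c i j) ^ 2) ^ (-((2 - α) / 2))| ≤ 1 := by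
      rw [abs_of_nonneg (by positivity)]
      apply Real.rpow_le_one_of_one_le_of_nonpos
      · have := sq_nonneg (c (i + p.1) (j + p.2) / c i j); linarith
      · linarith
    have e4 : |(1 + (j:ℝ)) ^ (-(β₂ * (α - 1)))| = (1 + (j:ℝ)) ^ (-(β₂ * (α - 1))) :=
      abs_of_nonneg (by positivity)
    rw [abs_mul, abs_mul, abs_mul, abs_mul, e4]
    calc _ ≤ M * 1 * M ^ (α - 1) * (1 + (j:ℝ)) ^ (-(β₂ * (α - 1))) * 1 := by
          gcongr
          exact hM _ _
      _ = _ := by ring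
  -- limit of B
  have hBlim : ∀ j, Tendsto (fun q : ℕ × (ℕ × ℕ) => auxB α β₂ w c j q.1 q.2)
      (atTop ×ˢ (atTop ×ˢ atTop)) (𝓝 (wco j ^ (α - 1) * (1 + (j : ℝ)) ^ (-(β₂ * (α - 1))))) := by
    intro j
    have hj0 : (0:ℝ) < 1 + j := by positivity
    have tI : Tendsto (fun q : ℕ × (ℕ × ℕ) => q.1) (atTop ×ˢ (atTop ×ˢ atTop)) atTop :=
      tendsto_fst
    have tN : Tendsto (fun q : ℕ × (ℕ × ℕ) => q.2.1) (atTop ×ˢ (atTop ×ˢ atTop)) atTop :=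
      tendsto_fst.comp tendsto_snd
    have tM : Tendsto (fun q : ℕ × (ℕ × ℕ) => q.2.2) (atTop ×ˢ (atTop ×ˢ atTop)) atTop :=
      tendsto_snd.comp tendsto_snd
    have t1 : Tendsto (fun q : ℕ × (ℕ × ℕ) => w (q.1 + q.2.1) (j + q.2.2))
        (atTop ×ˢ (atTop ×ˢ atTop)) (𝓝 1) :=
      hA1.comp ((tI.atTop_add_atTop tN).prodMk (tendsto_atTop_mono (fun q => Nat.le_add_left q.2.2 j) tM))
    have s1 : Tendsto (fun m : ℕ => (1 + (j:ℝ)) / (1 + j + m)) atTop (𝓝 0) :=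
      (tendsto_atTop_add_const_left _ (1 + (j:ℝ)) tendsto_natCast_atTop_atTop).const_div_atTop _
    have s2 : Tendsto (fun m : ℕ => (m:ℝ) / (1 + j + m)) atTop (𝓝 1) := by
      have := s1.const_sub 1
      rw [sub_zero] at this
      refine this.congr (fun m => ?_)
      field_simp; ring
    have t2 : Tendsto (fun q : ℕ × (ℕ × ℕ) => ((q.2.2 : ℝ) / (1 + j + q.2.2)) ^ β₂)
        (atTop ×ˢ (atTop ×ˢ atTop)) (𝓝 1) := by
      have := (s2.comp tM).rpow_const (p := β₂) (Or.inl one_ne_zero)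
      simpa using this
    have t3 : Tendsto (fun q : ℕ × (ℕ × ℕ) => w q.1 j * |w q.1 j| ^ (α - 2))
        (atTop ×ˢ (atTop ×ˢ atTop)) (𝓝 (wco j ^ (α - 1))) := by
      have hp := (hA3 j).2
      have h0 := (hA3 j).1.comp tI
      have := h0.mul (h0.abs.rpow_const (p := α - 2) (Or.inl (abs_pos.2 hp.ne').ne'))
      have e : wco j ^ (α - 1) = wco j * |wco j| ^ (α - 2) := by
        rw [abs_of_pos hp, show α - 1 = (α - 2) + 1 by ring, Real.rpow_add_one hp.ne']; ring
      rw [e]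
      exact this
    have t4 : Tendsto (fun q : ℕ × (ℕ × ℕ) => c (q.1 + q.2.1) (j + q.2.2) / c q.1 j)
        (atTop ×ˢ (atTop ×ˢ atTop)) (𝓝 0) := by
      have s3 : Tendsto (fun q : ℕ × (ℕ × ℕ) => M * D * ((1 + (j:ℝ)) / (1 + j + q.2.2)) ^ β₂)
          (atTop ×ˢ (atTop ×ˢ atTop)) (𝓝 0) := by
        have := ((s1.comp tM).rpow_const (p := β₂) (Or.inr hβ2pos.le)).const_mul (M * D)
        rw [Real.zero_rpow hβ2pos.ne', mul_zero] at this
        exact this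
      refine squeeze_zero_norm (fun q => ?_) s3
      obtain ⟨i, n, m⟩ := q
      simp only
      have hi0 : (0:ℝ) < 1 + i := by positivity
      have e : c (i + n) (j + m) / c i j = w (i + n) (j + m) * (w i j)⁻¹ *
          ((1 + (i:ℝ)) / (1 + i + n)) ^ β₁ * ((1 + (j:ℝ)) / (1 + j + m)) ^ β₂ := by
        rw [hc, hc, Real.div_rpow hi0.le (by positivity), Real.div_rpow hj0.le (by positivity),
          Real.rpow_neg hi0.le, Real.rpow_neg hj0.le, Real.rpow_neg (by positivity),
          Real.rpow_neg (by positivity)]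
        push_cast
        rw [← add_assoc, ← add_assoc]
        have : (0:ℝ) < (1 + (i:ℝ)) ^ β₁ := by positivity
        have : (0:ℝ) < (1 + (j:ℝ)) ^ β₂ := by positivity
        have : (0:ℝ) < (1 + (i:ℝ) + n) ^ β₁ := by positivity
        have : (0:ℝ) < (1 + (j:ℝ) + m) ^ β₂ := by positivity
        have := hw i j
        field_simp
      have e2 : |((1 + (i:ℝ)) / (1 + i + n)) ^ β₁| ≤ 1 := by
        rw [abs_of_nonneg (by positivity)]
        apply Real.rpow_le_one (by positivity) _ (by linarith)
        rw [div_le_one (by positivity)]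
        have : (0:ℝ) ≤ n := by positivity
        linarith
      have e3 : |((1 + (j:ℝ)) / (1 + j + m)) ^ β₂| = ((1 + (j:ℝ)) / (1 + j + m)) ^ β₂ :=
        abs_of_nonneg (by positivity)
      rw [e, Real.norm_eq_abs, abs_mul, abs_mul, abs_mul, e3]
      calc _ ≤ M * D * 1 * ((1 + (j:ℝ)) / (1 + j + m)) ^ β₂ := by
            gcongr
            · exact hM _ _
            · exact hD i j
        _ = _ := by ring
    have t5 : Tendsto (fun q : ℕ × (ℕ × ℕ) =>
        (1 + (c (q.1 + q.2.1) (j + q.2.2) / c q.1 j) ^ 2) ^ (-((2 - α) / 2)))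
        (atTop ×ˢ (atTop ×ˢ atTop)) (𝓝 1) := by
      have h := (t4.pow 2).const_add 1
      rw [show (1:ℝ) + 0 ^ 2 = 1 by norm_num] at h
      have := h.rpow_const (p := -((2 - α) / 2)) (Or.inl one_ne_zero)
      rwa [Real.one_rpow] at this
    have := (((t1.mul t2).mul t3).mul_const ((1 + (j : ℝ)) ^ (-(β₂ * (α - 1))))).mul t5
    rw [one_mul, one_mul, mul_one] at this
    exact this
  -- weights
  have tfst : Tendsto (fun p : ℕ × ℕ => p.1) (atTop ×ˢ atTop : Filter (ℕ × ℕ)) atTop := tendsto_fst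
  have tsnd : Tendsto (fun p : ℕ × ℕ => p.2) (atTop ×ˢ atTop : Filter (ℕ × ℕ)) atTop := tendsto_snd
  have hlog : Tendsto (fun n : ℕ => Real.log n) atTop atTop :=
    Real.tendsto_log_atTop.comp tendsto_natCast_atTop_atTop
  have hpos : ∀ᶠ p : ℕ × ℕ in atTop ×ˢ atTop, 0 < Real.log p.1 :=
    tfst.eventually (hlog.eventually_gt_atTop 0)
  have hW : ∀ᶠ p : ℕ × ℕ in atTop ×ˢ atTop, (∀ i, 0 ≤ auxA β₁ i p.1 / Real.log p.1) ∧
      Summable (fun i => auxA β₁ i p.1 / Real.log p.1) := by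
    filter_upwards [hpos] with p hp
    exact ⟨fun i => div_nonneg (auxA_nonneg _ _ _) hp.le, (auxA_summable β₁ hβ1 p.1).div_const _⟩
  have hW1 : Tendsto (fun p : ℕ × ℕ => ∑' i, auxA β₁ i p.1 / Real.log p.1) (atTop ×ˢ atTop)
      (𝓝 1) := by
    have := (auxA_tendsto β₁ hβ1).comp tfst
    refine this.congr (fun p => ?_)
    simp only [Function.comp, tsum_div_const]
  have hW0 : ∀ i, Tendsto (fun p : ℕ × ℕ => auxA β₁ i p.1 / Real.log p.1) (atTop ×ˢ atTop)
      (𝓝 0) := by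
    intro i
    have h1 : Tendsto (fun p : ℕ × ℕ => 1 / Real.log p.1) (atTop ×ˢ atTop) (𝓝 0) :=
      (hlog.const_div_atTop 1).comp tfst
    refine squeeze_zero' (hW.mono (fun p hp => hp.1 i)) ?_ h1
    filter_upwards [hpos] with p hp
    gcongr
    refine (auxA_le β₁ hβ1 i p.1).trans ?_
    have : (0:ℝ) ≤ 1 / (1 + i + p.1) := by positivity
    have : 1 / (1 + (i:ℝ)) ≤ 1 := by
      rw [div_le_one (by positivity)]; have : (0:ℝ) ≤ i := by positivity
      linarith
    linarith
  -- dominated convergence in j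
  have hdom : Tendsto (fun p : ℕ × ℕ => ∑' j, ∑' i, auxA β₁ i p.1 / Real.log p.1 *
      auxB α β₂ w c j i p) (atTop ×ˢ atTop)
      (𝓝 (∑' j : ℕ, wco j ^ (α - 1) * (1 + (j : ℝ)) ^ (-(β₂ * (α - 1))))) := by
    refine tendsto_tsum_of_dominated_convergence
      (bound := fun j : ℕ => 2 * (M * M ^ (α - 1) * (1 + (j:ℝ)) ^ (-(β₂ * (α - 1))))) ?_ ?_ ?_
    · refine Summable.mul_left _ (Summable.mul_left _ ?_)
      have := (summable_nat_add_iff 1).2 (Real.summable_nat_rpow.2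
        (show -(β₂ * (α - 1)) < -1 by linarith))
      refine this.congr (fun j => ?_)
      push_cast; rw [add_comm]
    · intro j
      exact aux_toeplitz (fun i p => auxA β₁ i p.1 / Real.log p.1) (fun i p => auxB α β₂ w c j i p)
        _ _ hW hW0 hW1 (hB j) (hBlim j)
    · filter_upwards [hW, hW1.eventually (gt_mem_nhds (show (1:ℝ) < 2 by norm_num))] with p hp hp2 j
      refine (tsum_of_norm_bounded (hp.2.mul_right
        (M * M ^ (α - 1) * (1 + (j:ℝ)) ^ (-(β₂ * (α - 1))))).hasSum (fun i => ?_)).trans ?_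
      · rw [norm_mul, Real.norm_of_nonneg (hp.1 i)]
        exact mul_le_mul_of_nonneg_left (hB j i p) (hp.1 i)
      · rw [tsum_mul_right]
        gcongr
  refine hdom.congr' ?_
  filter_upwards [tfst.eventually (eventually_ge_atTop 1), tsnd.eventually (eventually_ge_atTop 1)]
    with p hn hm
  rw [hρ _ _ hn hm, ← Summable.tsum_comm (f := fun i j => V α (c i j) (c (i + p.1) (j + p.2)))
    (hsum p.1 p.2 hn hm), ← tsum_div_const]
  refine tsum_congr (fun j => ?_)
  rw [← tsum_div_const]
  exact tsum_congr (fun i => (hV i j p.1 p.2 hn hm).symm)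
end
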